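/- arXiv:1309.4984 — 6 statements merged into one kernel-verified Lean document; each statement's English description precedes it below -/
import Mathlib

section
/- Suppose the LAN condition holds for a parameter set Θ ⊆ ℝ with 0 ∈ Θ whose closure has nonempty interior, and let S_n : Ω_n → ℝ be a Θ-regular sequence of estimators with limit Q. Then there exists a probability measure ν on ℝ such that for every θ ∈ Θ the law under P_{n,θ} of the pair (X_n, S_n − X_n/σ²) converges weakly on ℝ² to the product measure N(θσ², σ²) ⊗ ν; in particular the law of S_n − X_n/σ² under P_{n,θ} converges weakly to the same ν for every θ ∈ Θ. -/
open MeasureTheory ProbabilityTheory Filter Topology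

/-- Weak convergence of a sequence of measures: convergence of the integrals of all bounded
continuous functions. -/
def WeaklyTendsTo {α : Type*} [MeasurableSpace α] [TopologicalSpace α]
    (μ : ℕ → Measure α) (ν : Measure α) : Prop :=
  ∀ g : BoundedContinuousFunction α ℝ,
    Tendsto (fun n => ∫ x, g x ∂(μ n)) atTop (𝓝 (∫ x, g x ∂ν))


lemma exp_neg_mul_integral_sub_le_integral {Ω : Type*} [MeasurableSpace Ω] (p q : Measure Ω)
    [IsProbabilityMeasure p] [IsProbabilityMeasure q] {L G φ : Ω → ℝ} {C K ε : ℝ}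
    (hL : Measurable L) (hG : Measurable G) (hφ : Measurable φ)
    (hG0 : ∀ ω, 0 ≤ G ω) (hGC : ∀ ω, G ω ≤ C) (hφ0 : ∀ ω, 0 ≤ φ ω) (hφK : ∀ ω, φ ω ≤ K)
    (hφL : ∀ ω, φ ω ≤ Real.exp (L ω)) (hε : 0 < ε) (hφε : ∀ ω, |L ω| < ε → φ ω = 0) :
    Real.exp (-ε) * ∫ ω, φ ω * G ω ∂p
      - K * C * p.real {ω | ε ≤ |Real.log (q.rnDeriv p ω).toReal - L ω|} ≤ ∫ ω, G ω ∂q := by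
  set B := {ω | ε ≤ |Real.log (q.rnDeriv p ω).toReal - L ω|} with hB
  have hZm : Measurable fun ω => (q.rnDeriv p ω).toReal :=
    (Measure.measurable_rnDeriv q p).ennreal_toReal
  have hBm : MeasurableSet B := measurableSet_le measurable_const
    (((Real.measurable_log.comp hZm).sub hL).abs)
  have hGint : Integrable G q := Integrable.of_bound hG.aestronglyMeasurable C
    (.of_forall fun ω => by rw [Real.norm_eq_abs, abs_of_nonneg (hG0 ω)]; exact hGC ω)
  have hφGint : Integrable (fun ω => φ ω * G ω) p :=
    Integrable.of_bound (hφ.mul hG).aestronglyMeasurable (K * C) (.of_forall fun ω => by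
      rw [Real.norm_eq_abs, abs_of_nonneg (mul_nonneg (hφ0 ω) (hG0 ω))]
      exact mul_le_mul (hφK ω) (hGC ω) (hG0 ω) ((hφ0 ω).trans (hφK ω)))
  have hle : p.withDensity (q.rnDeriv p) ≤ q := Measure.withDensity_rnDeriv_le q p
  have h1 : ∫ ω, (q.rnDeriv p ω).toReal * G ω ∂p ≤ ∫ ω, G ω ∂q := by
    have := integral_withDensity_eq_integral_toReal_smul (Measure.measurable_rnDeriv q p)
      (Measure.rnDeriv_lt_top q p) G
    simp only [smul_eq_mul] at this
    rw [← this]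
    exact integral_mono_measure hle (.of_forall hG0) hGint
  have hZGint : Integrable (fun ω => (q.rnDeriv p ω).toReal * G ω) p := by
    have := (integrable_withDensity_iff_integrable_smul' (Measure.measurable_rnDeriv q p)
      (Measure.rnDeriv_lt_top q p) (g := G)).1 (hGint.mono_measure hle)
    simpa only [smul_eq_mul] using this
  have hBint : Integrable (B.indicator fun _ => K * C) p :=
    (integrable_const _).indicator hBm
  have h2 : ∫ ω, (Real.exp (-ε) * (φ ω * G ω) - B.indicator (fun _ => K * C) ω) ∂p
      ≤ ∫ ω, (q.rnDeriv p ω).toReal * G ω ∂p := by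
    refine integral_mono ((hφGint.const_mul _).sub hBint) hZGint fun ω => ?_
    have hexp : Real.exp (-ε) ≤ 1 := Real.exp_le_one_iff.2 (by linarith)
    have hZ0 : 0 ≤ (q.rnDeriv p ω).toReal := ENNReal.toReal_nonneg
    have hφG : 0 ≤ φ ω * G ω := mul_nonneg (hφ0 ω) (hG0 ω)
    by_cases hω : ω ∈ B
    · simp only [Set.indicator_of_mem hω]
      have : φ ω * G ω ≤ K * C :=
        mul_le_mul (hφK ω) (hGC ω) (hG0 ω) ((hφ0 ω).trans (hφK ω))
      have h3 : Real.exp (-ε) * (φ ω * G ω) ≤ φ ω * G ω := mul_le_of_le_one_left hφG hexp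
      have := mul_nonneg hZ0 (hG0 ω)
      linarith
    · simp only [Set.indicator_of_notMem hω, sub_zero]
      rw [← mul_assoc]
      refine mul_le_mul_of_nonneg_right ?_ (hG0 ω)
      simp only [hB, Set.mem_ofPred_eq, not_le] at hω
      rcases hZ0.eq_or_lt with hZ | hZ
      · rw [← hZ] at hω ⊢
        rw [hφε ω (by simpa using hω), mul_zero]
      · calc Real.exp (-ε) * φ ω ≤ Real.exp (-ε) * Real.exp (L ω) :=
              mul_le_mul_of_nonneg_left (hφL ω) (Real.exp_nonneg _)
          _ = Real.exp (L ω - ε) := by rw [← Real.exp_add]; ring_nf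
          _ ≤ Real.exp (Real.log (q.rnDeriv p ω).toReal) :=
              Real.exp_le_exp.2 (by linarith [(abs_lt.1 hω).1])
          _ = _ := Real.exp_log hZ
  rw [integral_sub (hφGint.const_mul _) hBint, integral_const_mul,
    integral_indicator_const _ hBm, smul_eq_mul] at h2
  linarith [mul_comm (p.real B) (K * C)]

/-- A continuous minorant of `exp ∘ ℓ`, bounded by `k` and vanishing where `k * |ℓ| ≤ 1`. -/
noncomputable def truncExp {E : Type*} (ℓ : E → ℝ) (k : ℕ) (y : E) : ℝ :=
  min (Real.exp (ℓ y)) k * min 1 (max 0 (k * |ℓ y| - 1))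

section truncExp

variable {E : Type*} (ℓ : E → ℝ) (k : ℕ) (y : E)

lemma truncExp_nonneg : 0 ≤ truncExp ℓ k y :=
  mul_nonneg (le_min (Real.exp_nonneg _) k.cast_nonneg) (le_min zero_le_one (le_max_left _ _))

lemma truncExp_le_min : truncExp ℓ k y ≤ min (Real.exp (ℓ y)) k :=
  mul_le_of_le_one_right (le_min (Real.exp_nonneg _) k.cast_nonneg) (min_le_left _ _)

lemma continuous_truncExp [TopologicalSpace E] (hℓ : Continuous ℓ) :
    Continuous (truncExp ℓ k) := by
  unfold truncExp
  fun_prop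

lemma truncExp_eq_zero (h : k * |ℓ y| ≤ 1) : truncExp ℓ k y = 0 := by
  simp [truncExp, h]

lemma tendsto_truncExp (h : ℓ y ≠ 0) :
    Tendsto (fun k => truncExp ℓ k y) atTop (𝓝 (Real.exp (ℓ y))) := by
  have h1 : ∀ᶠ k : ℕ in atTop, Real.exp (ℓ y) ≤ k :=
    tendsto_natCast_atTop_atTop.eventually_ge_atTop _
  have h2 : ∀ᶠ k : ℕ in atTop, 2 ≤ k * |ℓ y| :=
    (tendsto_natCast_atTop_atTop.atTop_mul_const (abs_pos.2 h)).eventually_ge_atTop _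
  refine tendsto_const_nhds.congr' ?_
  filter_upwards [h1, h2] with k hk1 hk2
  rw [truncExp, min_eq_left hk1, max_eq_right (by linarith), min_eq_left (by linarith), mul_one]

end truncExp

section Contiguity

variable {Ω : ℕ → Type*} [∀ n, MeasurableSpace (Ω n)] {p q : ∀ n, Measure (Ω n)}
  [∀ n, IsProbabilityMeasure (p n)] [∀ n, IsProbabilityMeasure (q n)]
  {E : Type*} [TopologicalSpace E] [MeasurableSpace E] [OpensMeasurableSpace E]
  {Y : ∀ n, Ω n → E} {ℓ : E → ℝ} {F : Filter ℕ} {ρ : Measure E}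

lemma eventually_lt_integral_of_logLikelihood [IsFiniteMeasure ρ]
    (hY : ∀ n, Measurable (Y n)) (hℓ : Continuous ℓ)
    (hLAN : ∀ ε > 0, Tendsto (fun n => p n {ω | ε ≤
      |Real.log ((q n).rnDeriv (p n) ω).toReal - ℓ (Y n ω)|}) F (𝓝 0))
    (hρ : ∀ g : BoundedContinuousFunction E ℝ,
      Tendsto (fun n => ∫ ω, g (Y n ω) ∂(p n)) F (𝓝 (∫ x, g x ∂ρ)))
    (hℓ0 : ∀ᵐ x ∂ρ, ℓ x ≠ 0) (hint : Integrable (fun x => Real.exp (ℓ x)) ρ)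
    (g : BoundedContinuousFunction E ℝ) (hg : ∀ x, 0 ≤ g x) {a : ℝ}
    (ha : a < ∫ x, Real.exp (ℓ x) * g x ∂ρ) :
    ∀ᶠ n in F, a < ∫ ω, g (Y n ω) ∂(q n) := by
  have hgC : ∀ x, g x ≤ ‖g‖ := fun x => (le_abs_self _).trans (g.norm_coe_le_norm x)
  have hDCT : Tendsto (fun k : ℕ => ∫ x, truncExp ℓ k x * g x ∂ρ) atTop
      (𝓝 (∫ x, Real.exp (ℓ x) * g x ∂ρ)) := by
    refine tendsto_integral_of_dominated_convergence (fun x => Real.exp (ℓ x) * ‖g‖)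
      (fun k => ((continuous_truncExp ℓ k hℓ).mul g.continuous).measurable.aestronglyMeasurable)
      (hint.mul_const _) (fun k => .of_forall fun x => ?_) ?_
    · rw [Real.norm_eq_abs, abs_of_nonneg (mul_nonneg (truncExp_nonneg ℓ k x) (hg x))]
      exact mul_le_mul ((truncExp_le_min ℓ k x).trans (min_le_left _ _)) (hgC x) (hg x)
        (Real.exp_nonneg _)
    · filter_upwards [hℓ0] with x hx
      exact (tendsto_truncExp ℓ x hx).mul_const _
  have hexp : Tendsto (fun k : ℕ => Real.exp (-(1 / (k : ℝ)))) atTop (𝓝 1) := by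
    have : Tendsto (fun k : ℕ => -(1 / (k : ℝ))) atTop (𝓝 (-0)) :=
      tendsto_one_div_atTop_nhds_zero_nat.neg
    simpa [Function.comp_def] using (Real.continuous_exp.tendsto _).comp this
  have hprod := hexp.mul hDCT
  rw [one_mul] at hprod
  obtain ⟨k, hk, hk0⟩ := ((hprod.eventually_const_lt ha).and (eventually_gt_atTop 0)).exists
  have hk0' : (0 : ℝ) < k := by exact_mod_cast hk0
  let ψ : BoundedContinuousFunction E ℝ := BoundedContinuousFunction.ofNormedAddCommGroup
    (truncExp ℓ k) (continuous_truncExp ℓ k hℓ) k fun x => by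
      rw [Real.norm_eq_abs, abs_of_nonneg (truncExp_nonneg ℓ k x)]
      exact (truncExp_le_min ℓ k x).trans (min_le_right _ _)
  have hbad := (ENNReal.tendsto_toReal ENNReal.zero_ne_top).comp
    (hLAN (1 / (k : ℝ)) (by positivity))
  have hlim := ((hρ (ψ * g)).const_mul (Real.exp (-(1 / (k : ℝ))))).sub
    (hbad.const_mul (k * ‖g‖))
  simp only [ENNReal.toReal_zero, mul_zero, sub_zero] at hlim
  filter_upwards [hlim.eventually_const_lt hk] with n hn
  refine hn.trans_le ?_
  have := exp_neg_mul_integral_sub_le_integral (p n) (q n) (L := fun ω => ℓ (Y n ω))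
    (G := fun ω => g (Y n ω)) (φ := fun ω => truncExp ℓ k (Y n ω)) (C := ‖g‖) (K := k)
    (ε := 1 / (k : ℝ)) (hℓ.measurable.comp (hY n)) (g.continuous.measurable.comp (hY n))
    ((continuous_truncExp ℓ k hℓ).measurable.comp (hY n)) (fun _ => hg _) (fun _ => hgC _)
    (fun _ => truncExp_nonneg _ _ _)
    (fun _ => (truncExp_le_min _ _ _).trans (min_le_right _ _))
    (fun _ => (truncExp_le_min _ _ _).trans (min_le_left _ _)) (by positivity)
    (fun ω hω => truncExp_eq_zero _ _ _ (by
      rw [lt_div_iff₀ hk0'] at hω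
      linarith))
  exact this

/-- **Le Cam's third lemma**: if the log-likelihood ratios are asymptotically `ℓ (Y n)` and `Y n`
converges in law to `ρ` under `p n`, then it converges in law to `exp ℓ • ρ` under `q n`. -/
theorem tendsto_integral_of_logLikelihood [IsFiniteMeasure ρ]
    (hY : ∀ n, Measurable (Y n)) (hℓ : Continuous ℓ)
    (hLAN : ∀ ε > 0, Tendsto (fun n => p n {ω | ε ≤
      |Real.log ((q n).rnDeriv (p n) ω).toReal - ℓ (Y n ω)|}) F (𝓝 0))
    (hρ : ∀ g : BoundedContinuousFunction E ℝ,
      Tendsto (fun n => ∫ ω, g (Y n ω) ∂(p n)) F (𝓝 (∫ x, g x ∂ρ)))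
    (hℓ0 : ∀ᵐ x ∂ρ, ℓ x ≠ 0) (hint : Integrable (fun x => Real.exp (ℓ x)) ρ)
    (hone : ∫ x, Real.exp (ℓ x) ∂ρ = 1) (g : BoundedContinuousFunction E ℝ) :
    Tendsto (fun n => ∫ ω, g (Y n ω) ∂(q n)) F (𝓝 (∫ x, Real.exp (ℓ x) * g x ∂ρ)) := by
  have hgq : ∀ n, Integrable (fun ω => g (Y n ω)) (q n) := fun n =>
    Integrable.of_bound (g.continuous.measurable.comp (hY n)).aestronglyMeasurable ‖g‖
      (.of_forall fun ω => g.norm_coe_le_norm _)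
  have hgρ : Integrable (fun x => Real.exp (ℓ x) * g x) ρ :=
    hint.mul_bdd (c := ‖g‖) g.continuous.measurable.aestronglyMeasurable
      (.of_forall fun x => g.norm_coe_le_norm _)
  have hb : ∀ x, |g x| ≤ ‖g‖ := g.norm_coe_le_norm
  let c := BoundedContinuousFunction.const E ‖g‖
  refine tendsto_order.2 ⟨fun a ha => ?_, fun a ha => ?_⟩
  · have := eventually_lt_integral_of_logLikelihood hY hℓ hLAN hρ hℓ0 hint (c + g)
      (a := ‖g‖ + a) (fun x => ?_) ?_
    · filter_upwards [this] with n hn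
      simp only [c, BoundedContinuousFunction.coe_add, Pi.add_apply,
        BoundedContinuousFunction.const_apply] at hn
      rw [integral_add (integrable_const _) (hgq n)] at hn
      simpa using hn
    · simp only [c, BoundedContinuousFunction.coe_add, Pi.add_apply,
        BoundedContinuousFunction.const_apply]
      linarith [(abs_le.1 (hb x)).1]
    · simp only [c, BoundedContinuousFunction.coe_add, Pi.add_apply,
        BoundedContinuousFunction.const_apply, mul_add]
      rw [integral_add (hint.mul_const _) hgρ, integral_mul_const, hone]
      linarith
  · have := eventually_lt_integral_of_logLikelihood hY hℓ hLAN hρ hℓ0 hint (c - g)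
      (a := ‖g‖ - a) (fun x => ?_) ?_
    · filter_upwards [this] with n hn
      simp only [c, BoundedContinuousFunction.coe_sub, Pi.sub_apply,
        BoundedContinuousFunction.const_apply] at hn
      rw [integral_sub (integrable_const _) (hgq n)] at hn
      simpa using hn
    · simp only [c, BoundedContinuousFunction.coe_sub, Pi.sub_apply,
        BoundedContinuousFunction.const_apply]
      linarith [(abs_le.1 (hb x)).2]
    · simp only [c, BoundedContinuousFunction.coe_sub, Pi.sub_apply,
        BoundedContinuousFunction.const_apply, mul_sub]
      rw [integral_sub (hint.mul_const _) hgρ, integral_mul_const, hone]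
      linarith

end Contiguity

lemma gaussianReal_withDensity_exp {v : NNReal} (hv : v ≠ 0) (θ : ℝ) :
    (gaussianReal 0 v).withDensity (fun x => ENNReal.ofReal (Real.exp (θ * x - θ ^ 2 * v / 2)))
      = gaussianReal (θ * v) v := by
  have hv' : (v : ℝ) ≠ 0 := by exact_mod_cast hv
  rw [gaussianReal_of_var_ne_zero _ hv, gaussianReal_of_var_ne_zero _ hv,
    ← withDensity_mul _ (measurable_gaussianPDF 0 v) (by fun_prop)]
  congr 1
  ext x
  simp only [Pi.mul_apply, gaussianPDF, gaussianPDFReal]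
  rw [← ENNReal.ofReal_mul (by positivity), mul_assoc, ← Real.exp_add]
  congr 3
  field_simp
  ring

lemma differentiable_integral_cexp_mul {α : Type*} [MeasurableSpace α] {μ : Measure α}
    {X : α → ℝ} {w : α → ℂ} (hX : Measurable X) (hw : Measurable w) (hw1 : ∀ a, ‖w a‖ ≤ 1)
    (hint : ∀ r : ℝ, Integrable (fun a => Real.exp (r * X a)) μ) :
    Differentiable ℂ fun z : ℂ => ∫ a, Complex.exp (z * X a) * w a ∂μ := by
  intro z₀
  have hbound (R : ℝ) (z : ℂ) (hz : ‖z‖ ≤ R) (a : α) : ‖Complex.exp (z * X a) * w a‖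
      ≤ Real.exp (R * |X a|) := by
    rw [norm_mul]
    refine (mul_le_of_le_one_right (norm_nonneg _) (hw1 a)).trans ?_
    rw [Complex.norm_exp, Complex.re_mul_ofReal]
    refine Real.exp_le_exp.2 ((le_abs_self _).trans ?_)
    rw [abs_mul]
    gcongr
    exact (Complex.abs_re_le_norm z).trans hz
  have habs (R : ℝ) (a : α) : Real.exp (R * |X a|)
      ≤ Real.exp (R * X a) + Real.exp (-R * X a) := by
    rcases abs_cases (X a) with ⟨h, -⟩ | ⟨h, -⟩ <;> rw [h]
    · linarith [Real.exp_nonneg (-R * X a)]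
    · rw [mul_neg, neg_mul]
      linarith [Real.exp_nonneg (R * X a)]
  have hmeas (z : ℂ) : AEStronglyMeasurable (fun a => Complex.exp (z * X a) * w a) μ :=
    Measurable.aestronglyMeasurable (by fun_prop)
  have hder := hasDerivAt_integral_of_dominated_loc_of_deriv_le (μ := μ) (𝕜 := ℂ)
    (F := fun z a => Complex.exp (z * X a) * w a)
    (F' := fun z a => X a * (Complex.exp (z * X a) * w a)) (x₀ := z₀)
    (s := Metric.ball z₀ 1)
    (bound := fun a => Real.exp ((‖z₀‖ + 2) * X a) + Real.exp (-(‖z₀‖ + 2) * X a))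
    (Metric.ball_mem_nhds _ one_pos) (.of_forall hmeas)
    (((hint ‖z₀‖).add (hint (-‖z₀‖))).mono' (hmeas z₀)
      (.of_forall fun a => (hbound _ z₀ le_rfl a).trans (habs _ a)))
    (Measurable.aestronglyMeasurable (by fun_prop))
    (.of_forall fun a z hz => ?_) ((hint _).add (hint _)) (.of_forall fun a z _ => ?_)
  · exact hder.2.differentiableAt
  · have hzR : ‖z‖ ≤ ‖z₀‖ + 1 := by
      have := norm_le_norm_add_norm_sub' z z₀
      rw [Metric.mem_ball, dist_eq_norm] at hz
      linarith
    refine le_trans ?_ (habs _ a)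
    rw [norm_mul, Complex.norm_real, Real.norm_eq_abs]
    calc |X a| * ‖Complex.exp (z * X a) * w a‖
        ≤ Real.exp |X a| * Real.exp ((‖z₀‖ + 1) * |X a|) :=
          mul_le_mul (by linarith [Real.add_one_le_exp |X a|]) (hbound _ z hzR a)
            (norm_nonneg _) (Real.exp_nonneg _)
      _ = Real.exp ((‖z₀‖ + 2) * |X a|) := by rw [← Real.exp_add]; congr 1; ring
  · have h1 : HasDerivAt (fun z : ℂ => Complex.exp (z * X a))
        (Complex.exp (z * X a) * (1 * X a)) z := ((hasDerivAt_id z).mul_const _).cexp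
    exact (h1.mul_const (w a)).congr_deriv (by ring)

lemma frequently_ofReal_mem_of_interior_closure {Θ : Set ℝ} {x : ℝ}
    (hx : x ∈ interior (closure Θ)) :
    ∃ᶠ z in 𝓝[≠] (x : ℂ), ∃ θ ∈ Θ, z = (θ : ℂ) := by
  have hreal : ∃ᶠ θ in 𝓝[≠] x, θ ∈ Θ := by
    rw [frequently_iff]
    intro U hU
    obtain ⟨V, hVo, hxV, hVU⟩ := mem_nhdsWithin.1 hU
    have hopen : IsOpen ((V ∩ interior (closure Θ)) ∩ {x}ᶜ) :=
      (hVo.inter isOpen_interior).inter isOpen_compl_singleton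
    have hne : ((V ∩ interior (closure Θ)) ∩ {x}ᶜ).Nonempty := by
      have : (V ∩ interior (closure Θ)) ∈ 𝓝 x :=
        (hVo.inter isOpen_interior).mem_nhds ⟨hxV, hx⟩
      exact (inferInstance : (𝓝[≠] x).NeBot).nonempty_of_mem
        (inter_mem (mem_nhdsWithin_of_mem_nhds this) self_mem_nhdsWithin)
    obtain ⟨y, hy⟩ := hne
    obtain ⟨θ, hθ, hθΘ⟩ := mem_closure_iff.1 (interior_subset hy.1.2) _ hopen hy
    exact ⟨θ, hVU ⟨hθ.1.1, hθ.2⟩, hθΘ⟩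
  have hmap : Tendsto (fun θ : ℝ => (θ : ℂ)) (𝓝[≠] x) (𝓝[≠] (x : ℂ)) :=
    tendsto_nhdsWithin_of_tendsto_nhds_of_eventually_within _
      (Complex.continuous_ofReal.continuousAt.tendsto.mono_left nhdsWithin_le_nhds)
      (by filter_upwards [self_mem_nhdsWithin] with θ hθ
          simpa using hθ)
  exact hmap.frequently (hreal.mono fun θ hθ => ⟨θ, hθ, rfl⟩)

/-- If all exponential tiltings of `ρ` with parameters in `Θ` send `x / v + t` to translates of
`Q`, then the characteristic function of `ρ` is determined by `Q`. -/
lemma integral_cexp_of_tilted_map_eq {Θ : Set ℝ} (hΘ : (interior (closure Θ)).Nonempty)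
    {v : NNReal} (hv : v ≠ 0) {ρ : Measure (ℝ × ℝ)}
    (hfst : ρ.map Prod.fst = gaussianReal 0 v) {Q : Measure ℝ}
    (htilt : ∀ θ ∈ Θ, (ρ.withDensity fun x =>
        ENNReal.ofReal (Real.exp (θ * x.1 - θ ^ 2 * v / 2))).map (fun x => x.1 / (v : ℝ) + x.2)
      = Q.map (· + θ)) (s u : ℝ) :
    ∫ x, Complex.exp ((s * x.1 + u * x.2 : ℝ) * Complex.I) ∂ρ
      = Complex.exp (-(v * s ^ 2 / 2)) * (Complex.exp (u ^ 2 / (2 * v)) * charFun Q u) := by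
  have hv' : (v : ℂ) ≠ 0 := by exact_mod_cast hv
  have hint (r : ℝ) : Integrable (fun x : ℝ × ℝ => Real.exp (r * x.1)) ρ := by
    have := integrable_exp_mul_gaussianReal (μ := 0) (v := v) r
    rw [← hfst] at this
    exact this.comp_measurable measurable_fst
  let w : ℝ × ℝ → ℂ := fun x => Complex.exp (u * (x.1 / v + x.2 : ℝ) * Complex.I)
  have hw : Measurable w := by fun_prop
  have hw1 (x : ℝ × ℝ) : ‖w x‖ ≤ 1 := by
    have : w x = Complex.exp ((u * (x.1 / v + x.2) : ℝ) * Complex.I) := by simp [w]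
    rw [this, Complex.norm_exp_ofReal_mul_I]
  have hdiff := differentiable_integral_cexp_mul (μ := ρ) measurable_fst hw hw1 hint
  have hdiff' : Differentiable ℂ fun z : ℂ =>
      Complex.exp (z ^ 2 * v / 2 + z * u * Complex.I) * charFun Q u := by fun_prop
  have heq (θ : ℝ) (hθ : θ ∈ Θ) : ∫ x, Complex.exp (θ * x.1) * w x ∂ρ
      = Complex.exp (θ ^ 2 * v / 2 + θ * u * Complex.I) * charFun Q u := by
    have h1 := congrArg (fun m => charFun m u) (htilt θ hθ)
    simp only [charFun_map_add_const] at h1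
    rw [charFun_apply_real, integral_map (by fun_prop)
      (Measurable.aestronglyMeasurable (by fun_prop)),
      integral_withDensity_eq_integral_toReal_smul (by fun_prop) (by simp)] at h1
    have h2 (x : ℝ × ℝ) : Complex.exp (θ * x.1) * w x = Complex.exp (θ ^ 2 * v / 2) *
        ((ENNReal.ofReal (Real.exp (θ * x.1 - θ ^ 2 * v / 2))).toReal •
          Complex.exp (u * (x.1 / v + x.2 : ℝ) * Complex.I)) := by
      rw [ENNReal.toReal_ofReal (Real.exp_nonneg _), Complex.real_smul,
        Complex.ofReal_exp, ← Complex.exp_add, ← Complex.exp_add, ← Complex.exp_add]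
      congr 1
      push_cast
      ring
    simp_rw [h2]
    rw [integral_const_mul, h1, Complex.exp_add, mul_assoc]
    congr 1
    rw [mul_comm]
    congr 2
    simp [mul_comm]
  obtain ⟨x₀, hx₀⟩ := hΘ
  have hfun := AnalyticOnNhd.eq_of_frequently_eq (z₀ := (x₀ : ℂ))
    (fun z _ => hdiff.analyticAt z) (fun z _ => hdiff'.analyticAt z)
    ((frequently_ofReal_mem_of_interior_closure hx₀).mono (by
      rintro z ⟨θ, hθ, rfl⟩
      exact heq θ hθ))
  have := congrFun hfun ((s - u / v) * Complex.I)
  simp only [w] at this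
  calc _ = ∫ x : ℝ × ℝ, Complex.exp ((s - u / v) * Complex.I * x.1)
        * Complex.exp (u * (x.1 / v + x.2 : ℝ) * Complex.I) ∂ρ := by
        congr 1
        ext x
        rw [← Complex.exp_add]
        congr 1
        push_cast
        ring
    _ = _ := by
        rw [this, ← mul_assoc, ← Complex.exp_add]
        congr 2
        field_simp
        ring_nf
        rw [Complex.I_sq]
        ring

lemma eq_prod_of_tilted_map_eq {Θ : Set ℝ} (hΘ : (interior (closure Θ)).Nonempty)
    {v : NNReal} (hv : v ≠ 0) {ρ : Measure (ℝ × ℝ)} [IsProbabilityMeasure ρ]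
    (hfst : ρ.map Prod.fst = gaussianReal 0 v) {Q : Measure ℝ}
    (htilt : ∀ θ ∈ Θ, (ρ.withDensity fun x =>
        ENNReal.ofReal (Real.exp (θ * x.1 - θ ^ 2 * v / 2))).map (fun x => x.1 / (v : ℝ) + x.2)
      = Q.map (· + θ)) :
    ρ = (gaussianReal 0 v).prod (ρ.map Prod.snd) ∧
      ∀ u, charFun (ρ.map Prod.snd) u = Complex.exp (u ^ 2 / (2 * v)) * charFun Q u := by
  have key := integral_cexp_of_tilted_map_eq hΘ hv hfst htilt
  have hsnd (u : ℝ) : charFun (ρ.map Prod.snd) u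
      = Complex.exp (u ^ 2 / (2 * v)) * charFun Q u := by
    rw [charFun_apply_real, integral_map (by fun_prop)
      (Measurable.aestronglyMeasurable (by fun_prop))]
    simpa using key 0 u
  have : IsProbabilityMeasure (ρ.map Prod.snd) :=
    Measure.isProbabilityMeasure_map measurable_snd.aemeasurable
  refine ⟨charFun_eq_prod_iff.1 fun t => ?_, hsnd⟩
  rw [hsnd, charFun_gaussianReal, charFun_apply, integral_map
    (WithLp.measurable_toLp _ _).aemeasurable (Measurable.aestronglyMeasurable (by fun_prop))]
  have h := key t.ofLp.1 t.ofLp.2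
  convert h using 2
  · ext x
    simp [WithLp.prod_inner_apply, mul_comm]
  · simp

lemma WeaklyTendsTo.map {E E' : Type*} [TopologicalSpace E] [MeasurableSpace E] [BorelSpace E]
    [TopologicalSpace E'] [MeasurableSpace E'] [BorelSpace E'] {μ : ℕ → Measure E} {ν : Measure E}
    (h : WeaklyTendsTo μ ν) {f : E → E'} (hf : Continuous f) :
    WeaklyTendsTo (fun n => (μ n).map f) (ν.map f) := by
  intro g
  simp only [integral_map hf.measurable.aemeasurable
    g.continuous.measurable.aestronglyMeasurable]
  exact h (g.compContinuous ⟨f, hf⟩)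

lemma isTightMeasureSet_range_of_weaklyTendsTo {μ : ℕ → Measure ℝ} {ν : Measure ℝ}
    [∀ n, IsProbabilityMeasure (μ n)] [IsProbabilityMeasure ν] (h : WeaklyTendsTo μ ν) :
    IsTightMeasureSet (Set.range μ) := by
  let μ' : ℕ → ProbabilityMeasure ℝ := fun n => ⟨μ n, inferInstance⟩
  let ν' : ProbabilityMeasure ℝ := ⟨ν, inferInstance⟩
  have h' : Tendsto μ' atTop (𝓝 ν') :=
    ProbabilityMeasure.tendsto_iff_forall_integral_tendsto.2 h
  exact isTightMeasureSet_of_tendsto_charFun (f := charFun ν) (by fun_prop)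
    (ProbabilityMeasure.tendsto_iff_tendsto_charFun.1 h')

lemma integral_withDensity_ofReal_exp {α : Type*} [MeasurableSpace α] {ρ : Measure α}
    {f : α → ℝ} (hf : Measurable f) (g : α → ℝ) :
    ∫ x, g x ∂(ρ.withDensity fun x => ENNReal.ofReal (Real.exp (f x)))
      = ∫ x, Real.exp (f x) * g x ∂ρ := by
  rw [integral_withDensity_eq_integral_toReal_smul (by fun_prop) (by simp)]
  simp [ENNReal.toReal_ofReal (Real.exp_nonneg _)]

lemma tendsto_integral_tilted {Θ : Set ℝ} {Ω : ℕ → Type*} [∀ n, MeasurableSpace (Ω n)]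
    {P : (n : ℕ) → ℝ → Measure (Ω n)} (hΘ0 : (0 : ℝ) ∈ Θ)
    (hP : ∀ n, ∀ θ ∈ Θ, IsProbabilityMeasure (P n θ)) {v : NNReal} (hv : v ≠ 0)
    {X T : (n : ℕ) → Ω n → ℝ} (hX : ∀ n, Measurable (X n)) (hT : ∀ n, Measurable (T n))
    (hLAN : ∀ θ ∈ Θ, ∀ ε > 0,
      Tendsto (fun n => P n 0 {ω | ε ≤
          |Real.log ((P n θ).rnDeriv (P n 0) ω).toReal
            - (θ * X n ω - θ ^ 2 * v / 2)|}) atTop (𝓝 0))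
    {F : Filter ℕ} (hF : F ≤ atTop) {ρ : Measure (ℝ × ℝ)} [IsProbabilityMeasure ρ]
    (hfst : ρ.map Prod.fst = gaussianReal 0 v)
    (hρ : ∀ g : BoundedContinuousFunction (ℝ × ℝ) ℝ,
      Tendsto (fun n => ∫ ω, g (X n ω, T n ω) ∂(P n 0)) F (𝓝 (∫ x, g x ∂ρ)))
    {θ : ℝ} (hθ : θ ∈ Θ) (g : BoundedContinuousFunction (ℝ × ℝ) ℝ) :
    Tendsto (fun n => ∫ ω, g (X n ω, T n ω) ∂(P n θ)) F
      (𝓝 (∫ x, Real.exp (θ * x.1 - θ ^ 2 * v / 2) * g x ∂ρ)) := by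
  rcases eq_or_ne θ 0 with rfl | hθ0
  · simpa using hρ g
  have := fun n => hP n 0 hΘ0
  have := fun n => hP n θ hθ
  have hmgf : Integrable (fun x : ℝ => Real.exp (θ * x - θ ^ 2 * v / 2)) (gaussianReal 0 v) := by
    simp_rw [Real.exp_sub]
    exact (integrable_exp_mul_gaussianReal θ).div_const _
  have hone : ∫ x : ℝ, Real.exp (θ * x - θ ^ 2 * v / 2) ∂(gaussianReal 0 v) = 1 := by
    have h := congrArg (fun m : Measure ℝ => ∫ _, (1 : ℝ) ∂m) (gaussianReal_withDensity_exp hv θ)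
    rw [integral_withDensity_ofReal_exp (by fun_prop)] at h
    simpa using h
  have hnull : ∀ᵐ x ∂(gaussianReal 0 v), θ * x - θ ^ 2 * v / 2 ≠ 0 := by
    have := nullSingletonClass_gaussianReal (μ := 0) hv
    have hs : ∀ᵐ x ∂(gaussianReal 0 v), x ≠ θ * v / 2 := by
      simp [ae_iff]
    filter_upwards [hs] with x hx h0
    refine hx (mul_left_cancel₀ hθ0 ?_)
    linarith
  rw [← hfst] at hmgf hone hnull
  rw [integral_map measurable_fst.aemeasurable
    (Measurable.aestronglyMeasurable (by fun_prop))] at hone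
  exact tendsto_integral_of_logLikelihood (p := fun n => P n 0) (q := fun n => P n θ)
    (Y := fun n ω => (X n ω, T n ω)) (ℓ := fun x => θ * x.1 - θ ^ 2 * v / 2)
    (fun n => (hX n).prodMk (hT n)) (by fun_prop)
    (fun ε hε => (hLAN θ hθ ε hε).mono_left hF) hρ
    (ae_of_ae_map measurable_fst.aemeasurable hnull)
    (hmgf.comp_measurable measurable_fst) hone g

lemma tilted_map_eq {Θ : Set ℝ} {Ω : ℕ → Type*} [∀ n, MeasurableSpace (Ω n)]
    {P : (n : ℕ) → ℝ → Measure (Ω n)} {v : NNReal}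
    {X S : (n : ℕ) → Ω n → ℝ} (hS : ∀ n, Measurable (S n))
    {Q : Measure ℝ} [IsProbabilityMeasure Q]
    (hreg : ∀ θ ∈ Θ, WeaklyTendsTo (fun n => (P n θ).map (S n)) (Q.map (· + θ)))
    {F : Filter ℕ} [F.NeBot] (hF : F ≤ atTop) {ρ : Measure (ℝ × ℝ)}
    (hfst : ρ.map Prod.fst = gaussianReal 0 v) {θ : ℝ} (hθ : θ ∈ Θ)
    (hρ : ∀ g : BoundedContinuousFunction (ℝ × ℝ) ℝ,
      Tendsto (fun n => ∫ ω, g (X n ω, S n ω - X n ω / v) ∂(P n θ)) F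
        (𝓝 (∫ x, Real.exp (θ * x.1 - θ ^ 2 * v / 2) * g x ∂ρ))) :
    (ρ.withDensity fun x => ENNReal.ofReal (Real.exp (θ * x.1 - θ ^ 2 * v / 2))).map
      (fun x => x.1 / (v : ℝ) + x.2) = Q.map (· + θ) := by
  have hmgf : Integrable (fun x : ℝ => Real.exp (θ * x - θ ^ 2 * v / 2)) (gaussianReal 0 v) := by
    simp_rw [Real.exp_sub]
    exact (integrable_exp_mul_gaussianReal θ).div_const _
  rw [← hfst] at hmgf
  have : IsFiniteMeasure
      (ρ.withDensity fun x => ENNReal.ofReal (Real.exp (θ * x.1 - θ ^ 2 * v / 2))) :=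
    isFiniteMeasure_withDensity_ofReal (hmgf.comp_measurable measurable_fst).2
  refine ext_of_forall_integral_eq_of_IsFiniteMeasure fun g => ?_
  have h1 := (hreg θ hθ g).mono_left hF
  have h2 := hρ (g.compContinuous ⟨fun x : ℝ × ℝ => x.1 / (v : ℝ) + x.2, by fun_prop⟩)
  have h3 (n : ℕ) : ∫ x, g x ∂((P n θ).map (S n)) = ∫ ω, g (S n ω) ∂(P n θ) :=
    integral_map (hS n).aemeasurable g.continuous.measurable.aestronglyMeasurable
  simp only [h3] at h1
  simp only [BoundedContinuousFunction.compContinuous_apply, ContinuousMap.coe_mk,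
    add_sub_cancel] at h2
  rw [integral_map (by fun_prop) g.continuous.measurable.aestronglyMeasurable,
    integral_withDensity_ofReal_exp (by fun_prop)]
  exact tendsto_nhds_unique h2 h1

/-- The convolution theorem for regular estimators, with the variance of the central sequence as a
nonnegative real. -/
theorem exists_tendsto_prod_of_regular
    {Θ : Set ℝ} (hΘ0 : (0 : ℝ) ∈ Θ) (hΘint : (interior (closure Θ)).Nonempty)
    {Ω : ℕ → Type*} [∀ n, MeasurableSpace (Ω n)]
    {P : (n : ℕ) → ℝ → Measure (Ω n)}
    (hP : ∀ n, ∀ θ ∈ Θ, IsProbabilityMeasure (P n θ)) {v : NNReal} (hv : v ≠ 0)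
    {X S : (n : ℕ) → Ω n → ℝ} (hX : ∀ n, Measurable (X n)) (hS : ∀ n, Measurable (S n))
    (hLAN : ∀ θ ∈ Θ, ∀ ε > 0,
      Tendsto (fun n => P n 0 {ω | ε ≤
          |Real.log ((P n θ).rnDeriv (P n 0) ω).toReal
            - (θ * X n ω - θ ^ 2 * v / 2)|}) atTop (𝓝 0))
    (hCLT : WeaklyTendsTo (fun n => (P n 0).map (X n)) (gaussianReal 0 v))
    {Q : Measure ℝ} [IsProbabilityMeasure Q]
    (hreg : ∀ θ ∈ Θ, WeaklyTendsTo (fun n => (P n θ).map (S n)) (Q.map (· + θ))) :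
    ∃ ν : Measure ℝ, IsProbabilityMeasure ν ∧ ∀ θ ∈ Θ,
      WeaklyTendsTo (fun n => (P n θ).map (fun ω => (X n ω, S n ω - X n ω / v)))
        ((gaussianReal (θ * v) v).prod ν) := by
  have hP0 := fun n => hP n 0 hΘ0
  have hT (n : ℕ) : Measurable fun ω => S n ω - X n ω / v := (hS n).sub ((hX n).div_const _)
  have hXT (n : ℕ) : Measurable fun ω => (X n ω, S n ω - X n ω / v) := (hX n).prodMk (hT n)
  have hmap (n : ℕ) (θ : ℝ) (g : BoundedContinuousFunction (ℝ × ℝ) ℝ) :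
      ∫ x, g x ∂((P n θ).map fun ω => (X n ω, S n ω - X n ω / v))
        = ∫ ω, g (X n ω, S n ω - X n ω / v) ∂(P n θ) :=
    integral_map (hXT n).aemeasurable g.continuous.measurable.aestronglyMeasurable
  let μ : ℕ → ProbabilityMeasure (ℝ × ℝ) := fun n =>
    ⟨(P n 0).map fun ω => (X n ω, S n ω - X n ω / v),
      Measure.isProbabilityMeasure_map (hXT n).aemeasurable⟩
  have htight : IsTightMeasureSet {((m : ProbabilityMeasure (ℝ × ℝ)) : Measure (ℝ × ℝ)) |
      m ∈ Set.range μ} := by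
    have := fun n => Measure.isProbabilityMeasure_map (μ := P n 0) (hX n).aemeasurable
    have := fun n => Measure.isProbabilityMeasure_map (μ := P n 0) (hS n).aemeasurable
    have h0 := hreg 0 hΘ0
    simp only [add_zero, Measure.map_id'] at h0
    have hXS : IsTightMeasureSet (Set.range fun n => (P n 0).map fun ω => (X n ω, S n ω)) := by
      refine IsTightMeasureSet.prodMk ?_ ?_
      · refine (isTightMeasureSet_range_of_weaklyTendsTo hCLT).subset ?_
        rintro _ ⟨_, ⟨n, rfl⟩, rfl⟩
        exact ⟨n, (Measure.fst_map_prodMk (hS n)).symm⟩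
      · refine (isTightMeasureSet_range_of_weaklyTendsTo h0).subset ?_
        rintro _ ⟨_, ⟨n, rfl⟩, rfl⟩
        exact ⟨n, (Measure.snd_map_prodMk (hX n)).symm⟩
    refine (hXS.map (f := fun x : ℝ × ℝ => (x.1, x.2 - x.1 / v)) (by fun_prop)).subset ?_
    rintro _ ⟨_, ⟨n, rfl⟩, rfl⟩
    exact ⟨_, ⟨n, rfl⟩, Measure.map_map (by fun_prop) ((hX n).prodMk (hS n))⟩
  have hcomp := isCompact_closure_of_isTightMeasureSet htight
  have hlim (U : Ultrafilter ℕ) : ∃ ρ, Tendsto μ U (𝓝 ρ) := by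
    obtain ⟨ρ, -, hρ⟩ := hcomp.ultrafilter_le_nhds (U.map μ) (by
      rw [le_principal_iff]
      exact Ultrafilter.mem_map.2 (Filter.univ_mem' fun n => subset_closure ⟨n, rfl⟩))
    exact ⟨ρ, hρ⟩
  have hchar (U : Ultrafilter ℕ) (hU : (U : Filter ℕ) ≤ atTop) (ρ : ProbabilityMeasure (ℝ × ℝ))
      (hρ : Tendsto μ U (𝓝 ρ)) : (ρ : Measure (ℝ × ℝ)).map Prod.fst = gaussianReal 0 v ∧
      (ρ : Measure (ℝ × ℝ)) = (gaussianReal 0 v).prod ((ρ : Measure (ℝ × ℝ)).map Prod.snd) ∧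
      ∀ u, charFun ((ρ : Measure (ℝ × ℝ)).map Prod.snd) u
        = Complex.exp (u ^ 2 / (2 * v)) * charFun Q u := by
    rw [ProbabilityMeasure.tendsto_iff_forall_integral_tendsto] at hρ
    simp only [μ, ProbabilityMeasure.coe_mk, hmap] at hρ
    have hfst : (ρ : Measure (ℝ × ℝ)).map Prod.fst = gaussianReal 0 v := by
      have := Measure.isProbabilityMeasure_map (μ := (ρ : Measure (ℝ × ℝ)))
        measurable_fst.aemeasurable
      refine ext_of_forall_integral_eq_of_IsFiniteMeasure fun g => ?_
      have h1 := (hCLT g).mono_left hU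
      have h2 := hρ (g.compContinuous ⟨Prod.fst, continuous_fst⟩)
      have h3 (n : ℕ) : ∫ x, g x ∂((P n 0).map (X n)) = ∫ ω, g (X n ω) ∂(P n 0) :=
        integral_map (hX n).aemeasurable g.continuous.measurable.aestronglyMeasurable
      simp only [h3] at h1
      rw [integral_map measurable_fst.aemeasurable
        g.continuous.measurable.aestronglyMeasurable]
      exact tendsto_nhds_unique h2 h1
    exact ⟨hfst, eq_prod_of_tilted_map_eq hΘint hv hfst fun θ hθ =>
      tilted_map_eq hS hreg hU hfst hθ
        (tendsto_integral_tilted hΘ0 hP hv hX hT hLAN hU hfst hρ hθ)⟩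
  obtain ⟨ρ, hρ⟩ := hlim (Ultrafilter.of atTop)
  obtain ⟨hfst, hprod, hsnd⟩ := hchar _ (Ultrafilter.of_le _) ρ hρ
  have hν : IsProbabilityMeasure ((ρ : Measure (ℝ × ℝ)).map Prod.snd) :=
    Measure.isProbabilityMeasure_map measurable_snd.aemeasurable
  have hμ : Tendsto μ atTop (𝓝 ρ) := by
    refine tendsto_iff_ultrafilter _ _ _ |>.2 fun U hU => ?_
    obtain ⟨ρ', hρ'⟩ := hlim U
    obtain ⟨-, hprod', hsnd'⟩ := hchar U hU ρ' hρ'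
    have := Measure.isProbabilityMeasure_map (μ := (ρ' : Measure (ℝ × ℝ)))
      measurable_snd.aemeasurable
    have heq : ρ' = ρ := by
      apply Subtype.ext
      change (ρ' : Measure (ℝ × ℝ)) = ρ
      rw [hprod', hprod, Measure.ext_of_charFun (funext fun u => (hsnd' u).trans (hsnd u).symm)]
    rwa [heq] at hρ'
  rw [ProbabilityMeasure.tendsto_iff_forall_integral_tendsto] at hμ
  simp only [μ, ProbabilityMeasure.coe_mk, hmap] at hμ
  refine ⟨_, hν, fun θ hθ g => ?_⟩
  simp only [hmap]
  have h := tendsto_integral_tilted hΘ0 hP hv hX hT hLAN le_rfl hfst hμ hθ g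
  rwa [← integral_withDensity_ofReal_exp (by fun_prop), hprod,
    ← prod_withDensity_left (f := fun x => ENNReal.ofReal (Real.exp (θ * x - θ ^ 2 * v / 2)))
      (by fun_prop), gaussianReal_withDensity_exp hv] at h

theorem stmt0
    (Θ : Set ℝ) (hΘ0 : (0 : ℝ) ∈ Θ) (hΘint : (interior (closure Θ)).Nonempty)
    (Ω : ℕ → Type*) [∀ n, MeasurableSpace (Ω n)]
    (P : (n : ℕ) → ℝ → Measure (Ω n))
    (hP : ∀ n, ∀ θ ∈ Θ, IsProbabilityMeasure (P n θ))
    (σ : ℝ) (hσ : 0 < σ)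
    (X : (n : ℕ) → Ω n → ℝ) (hX : ∀ n, Measurable (X n))
    -- LAN (i): the log-likelihood ratio expansion holds in `P n 0`-probability
    (hLAN : ∀ θ ∈ Θ, ∀ ε > 0,
      Tendsto (fun n => P n 0 {ω | ε ≤
          |Real.log ((P n θ).rnDeriv (P n 0) ω).toReal
            - (θ * X n ω - θ ^ 2 * σ ^ 2 / 2)|}) atTop (𝓝 0))
    -- LAN (ii): the central sequence is asymptotically `N(0, σ²)` under `P n 0`
    (hCLT : WeaklyTendsTo (fun n => (P n 0).map (X n))
      (gaussianReal 0 ⟨σ ^ 2, sq_nonneg σ⟩))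
    -- `S n` is a Θ-regular sequence of estimators with limit `Q`
    (S : (n : ℕ) → Ω n → ℝ) (hS : ∀ n, Measurable (S n))
    (Q : Measure ℝ) (hQ : IsProbabilityMeasure Q)
    (hreg : ∀ θ ∈ Θ, WeaklyTendsTo (fun n => (P n θ).map (S n)) (Q.map (· + θ))) :
    ∃ ν : Measure ℝ, IsProbabilityMeasure ν ∧
      (∀ θ ∈ Θ,
        WeaklyTendsTo (fun n => (P n θ).map (fun ω => (X n ω, S n ω - X n ω / σ ^ 2)))
          ((gaussianReal (θ * σ ^ 2) ⟨σ ^ 2, sq_nonneg σ⟩).prod ν)) ∧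
      (∀ θ ∈ Θ,
        WeaklyTendsTo (fun n => (P n θ).map (fun ω => S n ω - X n ω / σ ^ 2)) ν) := by
  let v : NNReal := ⟨σ ^ 2, sq_nonneg σ⟩
  have hv : v ≠ 0 := fun h => (pow_pos hσ 2).ne' (congrArg NNReal.toReal h)
  obtain ⟨ν, hν, hprod⟩ := exists_tendsto_prod_of_regular (v := v) hΘ0 hΘint hP hv hX hS hLAN
    hCLT hreg
  refine ⟨ν, hν, hprod, fun θ hθ => ?_⟩
  have h := (hprod θ hθ).map continuous_snd
  have hsnd : ((gaussianReal (θ * v) v).prod ν).map Prod.snd = ν := Measure.snd_prod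
  have hsnd' (n : ℕ) : ((P n θ).map fun ω => (X n ω, S n ω - X n ω / v)).map Prod.snd
      = (P n θ).map fun ω => S n ω - X n ω / v := Measure.snd_map_prodMk (hX n)
  simp only [hsnd, hsnd'] at h
  exact h
end

section
/- Suppose the LAN condition holds for a parameter set Θ ⊆ ℝ with 0 ∈ Θ whose closure has nonempty interior, and let S_n : Ω_n → ℝ be a Θ-regular sequence of estimators with limit Q. Then the following are equivalent: (i) S_n is asymptotically efficient, i.e. S_n − X_n/σ² → 0 in P_{n,0}-probability; (ii) Q ∗ ε_θ equals the Gaussian measure N(θ, 1/σ²) for at least one θ ∈ Θ. -/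
open MeasureTheory ProbabilityTheory Filter Topology

/-- Complex exponentials are square integrable for a measure with exponential moments. -/
lemma memLp_two_cexp_mul {μ : Measure ℝ}
    (hμ : ∀ r : ℝ, Integrable (fun x => Real.exp (r * x)) μ) (z : ℂ) :
    MemLp (fun x : ℝ => Complex.exp (z * x)) 2 μ := by
  rw [memLp_two_iff_integrable_sq_norm (by fun_prop)]
  refine (hμ (2 * z.re)).congr (ae_of_all _ fun x => ?_)
  simp only [Complex.norm_exp, ← Real.exp_nat_mul]
  congr 1
  simp
  ring

lemma memLp_two_exp_mul_abs {μ : Measure ℝ}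
    (hμ : ∀ r : ℝ, Integrable (fun x => Real.exp (r * x)) μ) (r : ℝ) :
    MemLp (fun x : ℝ => Real.exp (r * |x|)) 2 μ := by
  rw [memLp_two_iff_integrable_sq_norm (by fun_prop)]
  refine (integrable_exp_mul_abs (X := fun x : ℝ => x) (hμ (2 * r)) (hμ (-(2 * r)))).congr
    (ae_of_all _ fun x => ?_)
  simp only [Real.norm_eq_abs, Real.abs_exp, ← Real.exp_nat_mul]
  congr 1
  push_cast
  ring

/-- The Laplace transform of a square integrable function is entire. -/
lemma differentiable_integral_mul_cexp {μ : Measure ℝ}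
    (hμ : ∀ r : ℝ, Integrable (fun x => Real.exp (r * x)) μ) {h : ℝ → ℂ} (hh : MemLp h 2 μ) :
    Differentiable ℂ (fun z : ℂ => ∫ x : ℝ, h x * Complex.exp (z * x) ∂μ) := by
  intro z₀
  refine (hasDerivAt_integral_of_dominated_loc_of_deriv_le (𝕜 := ℂ) (s := Metric.ball z₀ 1)
    (F' := fun z x => h x * (Complex.exp (z * x) * x))
    (bound := fun x => ‖h x‖ * Real.exp ((‖z₀‖ + 2) * |x|))
    (Metric.ball_mem_nhds _ one_pos) ?_ ?_ ?_ ?_ ?_ ?_).2.differentiableAt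
  · exact Eventually.of_forall fun z => hh.1.mul (by fun_prop)
  · exact hh.integrable_mul (memLp_two_cexp_mul hμ z₀)
  · exact hh.1.mul (by fun_prop)
  · refine ae_of_all _ fun x z hz => ?_
    rw [norm_mul, norm_mul, Complex.norm_exp, Complex.norm_real, Real.norm_eq_abs]
    gcongr
    have h1 : ‖z‖ ≤ ‖z₀‖ + 1 := by
      have := norm_add_le z₀ (z - z₀)
      rw [add_sub_cancel] at this
      rw [mem_ball_iff_norm] at hz
      linarith
    have h2 : (z * x).re ≤ (‖z₀‖ + 1) * |x| := by
      refine (Complex.re_le_norm _).trans ?_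
      rw [norm_mul, Complex.norm_real, Real.norm_eq_abs]
      gcongr
    have h3 : |x| ≤ Real.exp |x| := by linarith [Real.add_one_le_exp |x|]
    calc Real.exp (z * x).re * |x| ≤ Real.exp ((‖z₀‖ + 1) * |x|) * Real.exp |x| := by gcongr
      _ = Real.exp ((‖z₀‖ + 2) * |x|) := by rw [← Real.exp_add]; congr 1; ring
  · exact hh.norm.integrable_mul (memLp_two_exp_mul_abs hμ _)
  · refine ae_of_all _ fun x z _ => ?_
    have h1 : HasDerivAt (fun z : ℂ => z * (x : ℂ)) (x : ℂ) z := by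
      simpa using (hasDerivAt_id z).mul_const (x : ℂ)
    exact h1.cexp.const_mul (h x)

lemma frequently_mem_of_interior_closure {Θ : Set ℝ} {x : ℝ} (hx : x ∈ interior (closure Θ)) :
    ∃ᶠ y in 𝓝[≠] x, y ∈ Θ := by
  have h1 : (closure Θ) ∈ 𝓝 x := mem_interior_iff_mem_nhds.1 hx
  rw [frequently_iff]
  intro U hU
  obtain ⟨V, hV, hxV, hVU⟩ := mem_nhdsWithin.1 hU
  have h2 : (V ∩ interior (closure Θ)) ∩ {x}ᶜ ∈ 𝓝[≠] x :=
    inter_mem (mem_nhdsWithin_of_mem_nhds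
      ((hV.inter isOpen_interior).mem_nhds ⟨hxV, hx⟩)) self_mem_nhdsWithin
  obtain ⟨y, ⟨hyV, hyc⟩, hyx⟩ := (NormedField.nhdsNE_neBot x).nonempty_of_mem h2
  obtain ⟨w, ⟨hwV, hwx⟩, hwΘ⟩ := mem_closure_iff.1 (interior_subset hyc) (V ∩ {x}ᶜ)
    (hV.inter isOpen_compl_singleton) ⟨hyV, hyx⟩
  exact ⟨w, hVU ⟨hwV, hwx⟩, hwΘ⟩

/-- If `Θ` is somewhere dense, the exponentials `exp (θ x)`, `θ ∈ Θ`, span an `L¹`-approximation of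
every exponential, for a probability measure with exponential moments. -/
lemma exists_integral_norm_cexp_sub_sum_lt {μ : Measure ℝ} [IsProbabilityMeasure μ]
    (hμ : ∀ r : ℝ, Integrable (fun x => Real.exp (r * x)) μ) {Θ : Set ℝ}
    (hΘ : (interior (closure Θ)).Nonempty) (w : ℂ) {ε : ℝ} (hε : 0 < ε) :
    ∃ (n : ℕ) (c : Fin n → ℂ) (θ : Fin n → ℝ), (∀ i, θ i ∈ Θ) ∧
      ∫ x : ℝ, ‖Complex.exp (w * x) - ∑ i, c i * Complex.exp (θ i * x)‖ ∂μ < ε := by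
  let e : ℂ → Lp ℂ 2 μ := fun z => (memLp_two_cexp_mul hμ z).toLp _
  let K : Submodule ℂ (Lp ℂ 2 μ) := Submodule.span ℂ ((fun θ : ℝ => e θ) '' Θ)
  have hmem : e w ∈ K.topologicalClosure := by
    rw [← Submodule.orthogonal_orthogonal_eq_closure, Submodule.mem_orthogonal]
    intro g hg
    have hinner : ∀ z, inner ℂ g (e z) = ∫ x : ℝ, star (g x) * Complex.exp (z * x) ∂μ := by
      intro z
      rw [L2.inner_def]
      refine integral_congr_ae ?_
      filter_upwards [(memLp_two_cexp_mul hμ z).coeFn_toLp] with x hx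
      simp only [e, hx, RCLike.inner_apply]
      rw [mul_comm]
      rfl
    have hd := differentiable_integral_mul_cexp hμ (h := fun x => star (g x)) (Lp.memLp g).star
    have hzero : (fun z : ℂ => ∫ x : ℝ, star (g x) * Complex.exp (z * x) ∂μ) = fun _ => 0 := by
      obtain ⟨x₀, hx₀⟩ := hΘ
      refine AnalyticOnNhd.eq_of_frequently_eq (z₀ := (x₀ : ℂ)) (fun z _ => hd.analyticAt z)
        (fun z _ => analyticAt_const) ?_
      have htend : Tendsto (fun y : ℝ => (y : ℂ)) (𝓝[≠] x₀) (𝓝[≠] (x₀ : ℂ)) :=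
        (Complex.continuous_ofReal.tendsto x₀).inf (by simp)
      refine htend.frequently ((frequently_mem_of_interior_closure hx₀).mono fun y hy => ?_)
      rw [← hinner, ← inner_conj_symm, (Submodule.mem_orthogonal K g).1 hg (e y)
        (Submodule.subset_span ⟨y, hy, rfl⟩), map_zero]
    rw [hinner]
    exact congrFun hzero w
  obtain ⟨v, hv, hvd⟩ := Metric.mem_closure_iff.1 hmem ε hε
  obtain ⟨n, c, s, hs⟩ := Submodule.mem_span_set'.1 hv
  choose θ hθ hθs using fun i => (s i).2
  refine ⟨n, c, θ, hθ, ?_⟩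
  set f : ℝ → ℂ := fun x => Complex.exp (w * x) - ∑ i, c i * Complex.exp (θ i * x) with hf
  have hfmem : MemLp f 2 μ := (memLp_two_cexp_mul hμ w).sub
    (memLp_finsetSum _ fun i _ => (memLp_two_cexp_mul hμ (θ i)).const_mul (c i))
  have hfv : hfmem.toLp f = e w - v := by
    have hsum : v = (memLp_finsetSum Finset.univ fun i _ =>
        (memLp_two_cexp_mul hμ (θ i)).const_mul (c i)).toLp
          (fun x : ℝ => ∑ i, c i * Complex.exp (θ i * x)) := by
      rw [← hs]
      refine Lp.ext ?_
      refine EventuallyEq.trans ?_ (MemLp.coeFn_toLp _).symm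
      refine (Lp.coeFn_finsetSum _ _).trans ?_
      have hi : ∀ i, (c i • (s i : Lp ℂ 2 μ) : Lp ℂ 2 μ) =ᵐ[μ]
          fun x : ℝ => c i * Complex.exp (θ i * x) := by
        intro i
        rw [← hθs i]
        filter_upwards [Lp.coeFn_smul (c i) (e (θ i)),
          (memLp_two_cexp_mul hμ (θ i)).coeFn_toLp] with x h1 h2
        rw [h1, Pi.smul_apply, smul_eq_mul, h2]
      filter_upwards [ae_all_iff.2 hi] with x hx
      simp [hx]
    rw [hsum]
    rfl
  rw [dist_eq_norm, ← hfv, Lp.norm_toLp] at hvd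
  refine lt_of_le_of_lt ?_ hvd
  rw [integral_norm_eq_lintegral_enorm hfmem.1, ← eLpNorm_one_eq_lintegral_enorm]
  exact ENNReal.toReal_mono hfmem.2.ne
    (eLpNorm_le_eLpNorm_of_exponent_le one_le_two hfmem.1)

/-- Replacing `ν` by the `P`-density `B` in an expectation costs at most the mass missing from `B`
plus twice the excess of `B` over the likelihood ratio. -/
lemma norm_integral_sub_integral_mul_le {Ω : Type*} [MeasurableSpace Ω] {P ν : Measure Ω}
    [IsProbabilityMeasure P] [IsProbabilityMeasure ν] {B : Ω → ℝ} (hB : Integrable B P)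
    {f : Ω → ℂ} (hf : Measurable f) (hf1 : ∀ ω, ‖f ω‖ ≤ 1) :
    ‖∫ ω, f ω ∂ν - ∫ ω, f ω * B ω ∂P‖ ≤
      1 - ∫ ω, B ω ∂P + 2 * ∫ ω, max (B ω - (ν.rnDeriv P ω).toReal) 0 ∂P := by
  set L : Ω → ℝ := fun ω => (ν.rnDeriv P ω).toReal with hL
  have hLint : Integrable L P := Measure.integrable_toReal_rnDeriv
  have hLtop : ∀ᵐ ω ∂P, ν.rnDeriv P ω < ⊤ := Measure.rnDeriv_lt_top ν P
  have hfint : ∀ (m : Measure Ω) [IsFiniteMeasure m], Integrable f m := fun m _ =>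
    Integrable.of_bound hf.aestronglyMeasurable 1 (ae_of_all _ hf1)
  have hdec := Measure.haveLebesgueDecomposition_add ν P
  have : IsFiniteMeasure (P.withDensity (ν.rnDeriv P)) :=
    isFiniteMeasure_of_le ν (Measure.withDensity_rnDeriv_le ν P)
  have hfL : Integrable (fun ω => f ω * L ω) P := by
    refine (hLint.ofReal (𝕜 := ℂ)).bdd_mul hf.aestronglyMeasurable (ae_of_all _ hf1)
  have hfB : Integrable (fun ω => f ω * B ω) P := by
    refine (hB.ofReal (𝕜 := ℂ)).bdd_mul hf.aestronglyMeasurable (ae_of_all _ hf1)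
  have hR : ∫ ω, f ω ∂ν = ∫ ω, f ω ∂(ν.singularPart P) + ∫ ω, f ω * L ω ∂P := by
    conv_lhs => rw [hdec]
    rw [integral_add_measure (hfint _) (hfint _),
      integral_withDensity_eq_integral_toReal_smul (Measure.measurable_rnDeriv ν P) hLtop]
    congr 1
    refine integral_congr_ae (ae_of_all _ fun ω => ?_)
    simp [hL, mul_comm]
  have hmass : (ν.singularPart P).real Set.univ + ∫ ω, L ω ∂P = 1 := by
    have h1 : ν.real Set.univ = 1 := by simp
    rw [hdec, measureReal_add_apply (measure_ne_top _ _) (measure_ne_top _ _)] at h1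
    rw [← h1]
    congr 1
    have h2 := integral_withDensity_eq_integral_toReal_smul (Measure.measurable_rnDeriv ν P)
      hLtop (fun _ => (1 : ℝ))
    simp only [integral_const, smul_eq_mul, mul_one] at h2
    exact h2.symm
  have hsing : ‖∫ ω, f ω ∂(ν.singularPart P)‖ ≤ (ν.singularPart P).real Set.univ := by
    simpa using norm_integral_le_of_norm_le_const (μ := ν.singularPart P) (ae_of_all _ hf1)
  have hpos : Integrable (fun ω => max (B ω - L ω) 0) P := (hB.sub hLint).pos_part
  have hac : ‖∫ ω, f ω * L ω ∂P - ∫ ω, f ω * B ω ∂P‖ ≤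
      ∫ ω, L ω ∂P - ∫ ω, B ω ∂P + 2 * ∫ ω, max (B ω - L ω) 0 ∂P := by
    rw [← integral_sub hfL hfB, ← integral_sub hLint hB, ← integral_const_mul,
      ← integral_add (f := fun ω => L ω - B ω) (hLint.sub hB) (hpos.const_mul 2)]
    refine norm_integral_le_of_norm_le ((hLint.sub hB).add (hpos.const_mul 2))
      (ae_of_all _ fun ω => ?_)
    rw [← mul_sub, norm_mul, ← Complex.ofReal_sub, Complex.norm_real, Real.norm_eq_abs]
    refine (mul_le_of_le_one_left (abs_nonneg _) (hf1 ω)).trans ?_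
    rcases le_total (B ω) (L ω) with h | h
    · rw [abs_of_nonneg (by linarith), max_eq_right (by linarith)]; linarith
    · rw [abs_of_nonpos (by linarith), max_eq_left (by linarith)]; linarith
  rw [hR, add_sub_assoc]
  refine (norm_add_le _ _).trans ?_
  linarith

lemma integral_max_min_exp_sub_le {Ω : Type*} [MeasurableSpace Ω] {P : Measure Ω}
    [IsProbabilityMeasure P] {L g : Ω → ℝ} (hL : Measurable L) (hL0 : ∀ ω, 0 ≤ L ω)
    (hg : Measurable g) {K η : ℝ} (hK : 0 ≤ K) (hη : 0 < η) :
    ∫ ω, max (min (Real.exp (g ω)) K - L ω) 0 ∂P ≤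
      K * (η + P.real {ω | η ≤ |Real.log (L ω) - g ω|} + P.real {ω | L ω = 0}) := by
  set A := {ω | η ≤ |Real.log (L ω) - g ω|}
  set Z := {ω | L ω = 0}
  have hA : MeasurableSet A := measurableSet_le measurable_const (by fun_prop)
  have hZ : MeasurableSet Z := hL (measurableSet_singleton 0)
  have hAi : Integrable (A.indicator fun _ => (1 : ℝ)) P :=
    (integrable_const 1).indicator hA
  have hZi : Integrable (Z.indicator fun _ => (1 : ℝ)) P :=
    (integrable_const 1).indicator hZ
  have hrhs : K * (η + P.real A + P.real Z) =
      ∫ ω, K * (η + A.indicator (fun _ => (1 : ℝ)) ω + Z.indicator (fun _ => (1 : ℝ)) ω) ∂P := by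
    rw [integral_const_mul,
      integral_add (f := fun ω => η + A.indicator _ ω) ((integrable_const η).add hAi) hZi,
      integral_add (integrable_const η) hAi, integral_indicator_const _ hA,
      integral_indicator_const _ hZ]
    simp
  rw [hrhs]
  refine integral_mono_of_nonneg (ae_of_all _ fun ω => le_max_right _ _)
    ((((integrable_const η).add hAi).add hZi).const_mul K) (ae_of_all _ fun ω => ?_)
  have hA0 : 0 ≤ A.indicator (fun _ => (1 : ℝ)) ω := Set.indicator_nonneg (by simp) ω
  have hZ0 : 0 ≤ Z.indicator (fun _ => (1 : ℝ)) ω := Set.indicator_nonneg (by simp) ω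
  have hbK : min (Real.exp (g ω)) K ≤ K := min_le_right _ _
  have hLω := hL0 ω
  refine max_le ?_ (by positivity)
  beta_reduce
  by_cases hωA : ω ∈ A
  · rw [Set.indicator_of_mem hωA]
    nlinarith
  by_cases hωZ : ω ∈ Z
  · rw [Set.indicator_of_mem hωZ]
    nlinarith
  have hLpos : 0 < L ω := lt_of_le_of_ne hLω (Ne.symm hωZ)
  have hlog : |Real.log (L ω) - g ω| < η := not_le.1 hωA
  have hb0 : 0 ≤ min (Real.exp (g ω)) K := le_min (Real.exp_pos _).le hK
  have h1 : (1 - η) * Real.exp (g ω) ≤ L ω := by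
    calc (1 - η) * Real.exp (g ω) ≤ Real.exp (-η) * Real.exp (g ω) := by
          gcongr
          linarith [Real.add_one_le_exp (-η)]
      _ = Real.exp (g ω - η) := by rw [← Real.exp_add]; congr 1; ring
      _ ≤ Real.exp (Real.log (L ω)) := Real.exp_le_exp.2 (by linarith [(abs_lt.1 hlog).1])
      _ = L ω := Real.exp_log hLpos
  rcases le_total η 1 with h | h
  · have h2 : (1 - η) * min (Real.exp (g ω)) K ≤ L ω :=
      (mul_le_mul_of_nonneg_left (min_le_left _ _) (by linarith)).trans h1
    nlinarith
  · nlinarith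

lemma WeaklyTendsTo.tendsto_integral {α : Type*} [MeasurableSpace α] [TopologicalSpace α]
    {μ : ℕ → Measure α} {ν : Measure α} (h : WeaklyTendsTo μ ν) {g : α → ℝ} (hg : Continuous g)
    {C : ℝ} (hC : ∀ x, |g x| ≤ C) :
    Tendsto (fun n => ∫ x, g x ∂(μ n)) atTop (𝓝 (∫ x, g x ∂ν)) :=
  h (BoundedContinuousFunction.ofNormedAddCommGroup g hg C hC)

lemma WeaklyTendsTo.tendsto_integral_complex {α : Type*} [MeasurableSpace α] [TopologicalSpace α]
    [OpensMeasurableSpace α] {μ : ℕ → Measure α} {ν : Measure α} [∀ n, IsProbabilityMeasure (μ n)]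
    [IsProbabilityMeasure ν] (h : WeaklyTendsTo μ ν) {g : α → ℂ} (hg : Continuous g)
    {C : ℝ} (hC : ∀ x, ‖g x‖ ≤ C) :
    Tendsto (fun n => ∫ x, g x ∂(μ n)) atTop (𝓝 (∫ x, g x ∂ν)) := by
  have hsplit : ∀ (m : Measure α) [IsProbabilityMeasure m],
      ∫ x, g x ∂m = ((∫ x, (g x).re ∂m : ℝ) : ℂ) + ((∫ x, (g x).im ∂m : ℝ) : ℂ) * Complex.I := by
    intro m _
    have hint : Integrable g m :=
      Integrable.of_bound hg.measurable.aestronglyMeasurable C (ae_of_all _ hC)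
    exact (integral_re_add_im hint).symm
  simp_rw [hsplit]
  have hre := h.tendsto_integral (g := fun x => (g x).re) (by fun_prop)
    (fun x => (Complex.abs_re_le_norm _).trans (hC x))
  have him := h.tendsto_integral (g := fun x => (g x).im) (by fun_prop)
    (fun x => (Complex.abs_im_le_norm _).trans (hC x))
  exact ((Complex.continuous_ofReal.tendsto _).comp hre).add
    (((Complex.continuous_ofReal.tendsto _).comp him).mul_const _)

section Sequences

variable {Ω : ℕ → Type*} [∀ n, MeasurableSpace (Ω n)] {P : (n : ℕ) → Measure (Ω n)}
  [∀ n, IsProbabilityMeasure (P n)] {X : (n : ℕ) → Ω n → ℝ} {N : Measure ℝ}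
  [IsProbabilityMeasure N] {Λ : ℝ → ℝ}

lemma tendsto_measureReal_eq_zero_of_log (hX : ∀ n, Measurable (X n))
    (hweak : WeaklyTendsTo (fun n => (P n).map (X n)) N) (hΛ : Continuous Λ)
    (hN : ∀ᵐ x ∂N, Λ x ≠ 0) {L : (n : ℕ) → Ω n → ℝ}
    (hlog : ∀ ε > 0, Tendsto
      (fun n => (P n).real {ω | ε ≤ |Real.log (L n ω) - Λ (X n ω)|}) atTop (𝓝 0)) :
    Tendsto (fun n => (P n).real {ω | L n ω = 0}) atTop (𝓝 0) := by
  let φ : ℕ → ℝ → ℝ := fun k x => max 0 (2 - (k + 1) * |Λ x|)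
  have hφc : ∀ k, Continuous (φ k) := fun k => by fun_prop
  have hφ0 : ∀ k x, 0 ≤ φ k x := fun k x => le_max_left _ _
  have hφ2 : ∀ k x, |φ k x| ≤ 2 := fun k x => by
    rw [abs_of_nonneg (hφ0 k x)]
    exact max_le (by norm_num) (sub_le_self _ (by positivity))
  have hφlim : Tendsto (fun k => ∫ x, φ k x ∂N) atTop (𝓝 0) := by
    have h0 : (0 : ℝ) = ∫ _, (0 : ℝ) ∂N := by simp
    rw [h0]
    refine tendsto_integral_of_dominated_convergence (fun _ => 2)
      (fun k => (hφc k).measurable.aestronglyMeasurable) (integrable_const _)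
      (fun k => ae_of_all _ fun x => hφ2 k x) ?_
    filter_upwards [hN] with x hx
    have hx' : 0 < |Λ x| := abs_pos.2 hx
    obtain ⟨k₀, hk₀⟩ := exists_nat_gt (2 / |Λ x|)
    refine tendsto_const_nhds.congr' ?_
    filter_upwards [eventually_ge_atTop k₀] with k hk
    have hk' : (k₀ : ℝ) ≤ k := by exact_mod_cast hk
    rw [div_lt_iff₀ hx'] at hk₀
    refine (max_eq_left ?_).symm
    nlinarith
  rw [Metric.tendsto_atTop']
  intro ε hε
  obtain ⟨k, hk⟩ := (hφlim.eventually (gt_mem_nhds (half_pos hε))).exists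
  have h1 := (hlog (1 / (k + 1)) (by positivity)).add
    (hweak.tendsto_integral (hφc k) (hφ2 k))
  have h2 : 0 + ∫ x, φ k x ∂N < ε := by linarith
  obtain ⟨n₀, hn₀⟩ := eventually_atTop.1 (h1.eventually (gt_mem_nhds h2))
  refine ⟨n₀, fun n hn => ?_⟩
  rw [Real.dist_eq, sub_zero, abs_of_nonneg measureReal_nonneg]
  refine lt_of_le_of_lt ?_ (hn₀ n hn.le)
  rw [integral_map (hX n).aemeasurable (hφc k).measurable.aestronglyMeasurable]
  have hφX : Measurable fun ω => φ k (X n ω) := (hφc k).measurable.comp (hX n)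
  have hsub : {ω | L n ω = 0} ⊆ {ω | 1 / ((k : ℝ) + 1) ≤ |Real.log (L n ω) - Λ (X n ω)|} ∪
      {ω | 1 ≤ φ k (X n ω)} := by
    intro ω hω
    rcases le_or_gt (1 / ((k : ℝ) + 1)) |Real.log (L n ω) - Λ (X n ω)| with h | h
    · exact Or.inl h
    · right
      have hω' : L n ω = 0 := hω
      rw [hω', Real.log_zero, zero_sub, abs_neg, lt_div_iff₀ (by positivity)] at h
      exact le_max_of_le_right
        (show (1 : ℝ) ≤ 2 - ((k : ℝ) + 1) * |Λ (X n ω)| by linarith)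
  refine (measureReal_mono hsub).trans ((measureReal_union_le _ _).trans ?_)
  gcongr
  have := mul_meas_ge_le_integral_of_nonneg (ae_of_all _ fun ω => hφ0 k (X n ω))
    (Integrable.of_bound hφX.aestronglyMeasurable 2 (ae_of_all _ fun ω => hφ2 k (X n ω)) :
      Integrable (fun ω => φ k (X n ω)) (P n)) 1
  simpa using this

lemma exists_truncated_density (hX : ∀ n, Measurable (X n))
    (hweak : WeaklyTendsTo (fun n => (P n).map (X n)) N) (hΛ : Continuous Λ)
    (hint : Integrable (fun x => Real.exp (Λ x)) N) (hone : ∫ x, Real.exp (Λ x) ∂N = 1)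
    {ν : (n : ℕ) → Measure (Ω n)} [∀ n, IsProbabilityMeasure (ν n)]
    (hlog : ∀ ε > 0, Tendsto (fun n => (P n).real
      {ω | ε ≤ |Real.log ((ν n).rnDeriv (P n) ω).toReal - Λ (X n ω)|}) atTop (𝓝 0))
    (hzero : Tendsto (fun n => (P n).real {ω | ((ν n).rnDeriv (P n) ω).toReal = 0}) atTop (𝓝 0))
    {δ : ℝ} (hδ : 0 < δ) :
    ∃ K : ℝ, 0 ≤ K ∧ ∫ x, (Real.exp (Λ x) - min (Real.exp (Λ x)) K) ∂N < δ ∧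
      ∀ᶠ n in atTop, ∀ f : Ω n → ℂ, Measurable f → (∀ ω, ‖f ω‖ ≤ 1) →
        ‖∫ ω, f ω ∂(ν n) - ∫ ω, f ω * (min (Real.exp (Λ (X n ω))) K : ℝ) ∂(P n)‖ ≤ δ := by
  have hbc : ∀ K : ℝ, Continuous fun x => min (Real.exp (Λ x)) K := fun K => by fun_prop
  have hb : ∀ {K : ℝ}, 0 ≤ K → ∀ x, |min (Real.exp (Λ x)) K| ≤ K := fun hK x => by
    rw [abs_of_nonneg (le_min (Real.exp_pos _).le hK)]
    exact min_le_right _ _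
  have hbi : ∀ {K : ℝ}, 0 ≤ K → Integrable (fun x => min (Real.exp (Λ x)) K) N := fun hK =>
    Integrable.of_bound (hbc _).measurable.aestronglyMeasurable _ (ae_of_all _ (hb hK))
  have hlim : Tendsto (fun k : ℕ => ∫ x, min (Real.exp (Λ x)) k ∂N) atTop (𝓝 1) := by
    rw [← hone]
    refine tendsto_integral_of_dominated_convergence (fun x => Real.exp (Λ x))
      (fun k => (hbc k).measurable.aestronglyMeasurable) hint
      (fun k => ae_of_all _ fun x => ?_) (ae_of_all _ fun x => ?_)
    · rw [Real.norm_eq_abs, abs_of_nonneg (le_min (Real.exp_pos _).le k.cast_nonneg)]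
      exact min_le_left _ _
    · obtain ⟨k₀, hk₀⟩ := exists_nat_ge (Real.exp (Λ x))
      refine tendsto_const_nhds.congr' ?_
      filter_upwards [eventually_ge_atTop k₀] with k hk
      have hk' : (k₀ : ℝ) ≤ k := by exact_mod_cast hk
      exact (min_eq_left (hk₀.trans hk')).symm
  obtain ⟨k, hk⟩ := (hlim.eventually (lt_mem_nhds (show 1 - δ / 2 < 1 by linarith))).exists
  have hK : (0 : ℝ) ≤ k := k.cast_nonneg
  refine ⟨k, hK, ?_, ?_⟩
  · rw [integral_sub hint (hbi hK), hone]
    linarith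
  set η : ℝ := δ / (8 * (k + 1)) with hη_def
  have hη : 0 < η := by positivity
  have hKη : 2 * (k * η) ≤ δ / 4 := by
    rw [hη_def, ← mul_assoc, mul_div_assoc', div_le_div_iff₀ (by positivity) (by norm_num)]
    nlinarith
  have hconv : Tendsto (fun n => 1 - ∫ ω, min (Real.exp (Λ (X n ω))) k ∂(P n) +
      2 * (k * (η + (P n).real {ω | η ≤ |Real.log ((ν n).rnDeriv (P n) ω).toReal - Λ (X n ω)|} +
        (P n).real {ω | ((ν n).rnDeriv (P n) ω).toReal = 0}))) atTop
      (𝓝 (1 - ∫ x, min (Real.exp (Λ x)) k ∂N + 2 * (k * (η + 0 + 0)))) := by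
    refine Tendsto.add (tendsto_const_nhds.sub ?_)
      (((((tendsto_const_nhds.add (hlog η hη)).add hzero)).const_mul _).const_mul _)
    refine (hweak.tendsto_integral (hbc k) (hb hK)).congr fun n => ?_
    rw [integral_map (hX n).aemeasurable (hbc k).measurable.aestronglyMeasurable]
  have hlt : 1 - ∫ x, min (Real.exp (Λ x)) k ∂N + 2 * (k * (η + 0 + 0)) < δ := by
    rw [add_zero, add_zero]
    linarith
  filter_upwards [hconv.eventually (gt_mem_nhds hlt)] with n hn f hf hf1
  have hΛX : Measurable fun ω => Λ (X n ω) := hΛ.measurable.comp (hX n)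
  have hBi : Integrable (fun ω => min (Real.exp (Λ (X n ω))) (k : ℝ)) (P n) :=
    Integrable.of_bound ((hbc k).measurable.comp (hX n)).aestronglyMeasurable _
      (ae_of_all _ fun ω => hb hK (X n ω))
  refine (norm_integral_sub_integral_mul_le hBi hf hf1).trans (le_trans ?_ hn.le)
  gcongr
  exact integral_max_min_exp_sub_le (Measure.measurable_rnDeriv _ _).ennreal_toReal
    (fun _ => ENNReal.toReal_nonneg) hΛX hK hη

end Sequences

/-- If the limits of the expectations of `f n` under the alternatives indexed by a somewhere dense
set agree with those of `exp (-w X)` in the limiting exponential family, then `f n` is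
asymptotically inverse to `exp (w X n)` under the base measure. -/
lemma tendsto_integral_mul_cexp_one {Ω : ℕ → Type*} [∀ n, MeasurableSpace (Ω n)]
    {P : (n : ℕ) → ℝ → Measure (Ω n)} {P₀ : (n : ℕ) → Measure (Ω n)}
    [∀ n, IsProbabilityMeasure (P₀ n)] {X : (n : ℕ) → Ω n → ℝ} (hX : ∀ n, Measurable (X n))
    {N : Measure ℝ} [IsProbabilityMeasure N]
    (hN : ∀ r : ℝ, Integrable (fun x => Real.exp (r * x)) N)
    (hweak : WeaklyTendsTo (fun n => (P₀ n).map (X n)) N)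
    {Θ : Set ℝ} (hΘ : (interior (closure Θ)).Nonempty) {κ : ℝ → ℝ}
    (happrox : ∀ θ ∈ Θ, ∀ δ > 0, ∃ K : ℝ, 0 ≤ K ∧
      ∫ x, (Real.exp (θ * x - κ θ) - min (Real.exp (θ * x - κ θ)) K) ∂N < δ ∧
      ∀ᶠ n in atTop, ∀ f : Ω n → ℂ, Measurable f → (∀ ω, ‖f ω‖ ≤ 1) →
        ‖∫ ω, f ω ∂(P n θ) -
          ∫ ω, f ω * (min (Real.exp (θ * X n ω - κ θ)) K : ℝ) ∂(P₀ n)‖ ≤ δ)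
    {w : ℂ} (hw : w.re = 0) {f : (n : ℕ) → Ω n → ℂ} (hf : ∀ n, Measurable (f n))
    (hf1 : ∀ n ω, ‖f n ω‖ ≤ 1)
    (hlim : ∀ θ ∈ Θ, Tendsto (fun n => ∫ ω, f n ω ∂(P n θ)) atTop
      (𝓝 (∫ x, Complex.exp (-w * x) * (Real.exp (θ * x - κ θ) : ℝ) ∂N))) :
    Tendsto (fun n => ∫ ω, f n ω * Complex.exp (w * X n ω) ∂(P₀ n)) atTop (𝓝 1) := by
  have hexp : ∀ x : ℝ, ‖Complex.exp (w * x)‖ = 1 := fun x => by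
    rw [Complex.norm_exp]; simp [hw]
  have hexp' : ∀ x : ℝ, ‖Complex.exp (-w * x)‖ = 1 := fun x => by
    rw [Complex.norm_exp]; simp [hw]
  have hℓi : ∀ θ : ℝ, Integrable (fun x => Real.exp (θ * x - κ θ)) N := fun θ => by
    simp_rw [Real.exp_sub]
    exact (hN θ).div_const _
  rw [Metric.tendsto_nhds]
  intro ε₀ hε₀
  set ε := ε₀ / 6 with hε_def
  have hε : 0 < ε := by positivity
  obtain ⟨m, c, θ, hθ, hc⟩ := exists_integral_norm_cexp_sub_sum_lt hN hΘ w hε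
  set a : Fin m → ℂ := fun i => c i * Real.exp (κ (θ i)) with ha
  set ℓ : Fin m → ℝ → ℝ := fun i x => Real.exp (θ i * x - κ (θ i)) with hℓ
  have hcℓ : ∀ i (x : ℝ), c i * Complex.exp (θ i * x) = a i * ℓ i x := by
    intro i x
    simp only [ha, hℓ]
    push_cast
    rw [mul_assoc, ← Complex.exp_add]
    congr 2
    ring
  simp_rw [hcℓ] at hc
  set A : ℝ := ∑ i, ‖a i‖ with hA
  have hA0 : 0 ≤ A := Finset.sum_nonneg fun i _ => norm_nonneg _
  set δ : ℝ := ε / (A + 1) with hδ_def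
  have hδ : 0 < δ := by positivity
  have hAδ : A * δ ≤ ε := by
    rw [hδ_def, mul_div_assoc', div_le_iff₀ (by positivity)]
    nlinarith
  choose K hK0 hKN hKn using fun i => happrox (θ i) (hθ i) δ hδ
  set b : Fin m → ℝ → ℝ := fun i x => min (ℓ i x) (K i) with hb
  have hℓc : ∀ i, Continuous (ℓ i) := fun i => by fun_prop
  have hbc : ∀ i, Continuous (b i) := fun i => by fun_prop
  have hbK : ∀ i x, |b i x| ≤ K i := fun i x => by
    rw [abs_of_nonneg (le_min (Real.exp_pos _).le (hK0 i))]
    exact min_le_right _ _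
  have hbi : ∀ i, Integrable (b i) N := fun i =>
    Integrable.of_bound (hbc i).measurable.aestronglyMeasurable _ (ae_of_all _ (hbK i))
  -- the bounded continuous discrepancy between `exp (w x)` and its truncated approximation
  set G : ℝ → ℝ := fun x => ‖Complex.exp (w * x) - ∑ i, a i * b i x‖ with hG
  have hGc : Continuous G := by fun_prop
  have hGb : ∀ x, |G x| ≤ 1 + ∑ i, ‖a i‖ * K i := by
    intro x
    rw [abs_of_nonneg (norm_nonneg _)]
    refine (norm_sub_le _ _).trans (add_le_add (hexp x).le ?_)
    refine (norm_sum_le _ _).trans (Finset.sum_le_sum fun i _ => ?_)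
    rw [norm_mul, Complex.norm_real, Real.norm_eq_abs]
    gcongr
    exact hbK i x
  have hHi : Integrable (fun x : ℝ => Complex.exp (w * x) - ∑ i, a i * ℓ i x) N := by
    refine Integrable.sub (Integrable.of_bound (by fun_prop) 1 (ae_of_all _ fun x => (hexp x).le))
      (integrable_finsetSum _ fun i _ => ?_)
    exact ((hℓi (θ i)).ofReal (𝕜 := ℂ)).const_mul (a i)
  have hGN : ∫ x, G x ∂N ≤ 2 * ε := by
    have hpt : ∀ x, G x ≤ ‖Complex.exp (w * x) - ∑ i, a i * ℓ i x‖ +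
        ∑ i, ‖a i‖ * (ℓ i x - b i x) := by
      intro x
      have h1 : Complex.exp (w * x) - ∑ i, a i * b i x =
          (Complex.exp (w * x) - ∑ i, a i * ℓ i x) + ∑ i, a i * ((ℓ i x - b i x : ℝ) : ℂ) := by
        simp only [Complex.ofReal_sub, mul_sub, Finset.sum_sub_distrib]
        ring
      rw [hG]
      beta_reduce
      rw [h1]
      refine (norm_add_le _ _).trans (add_le_add le_rfl ((norm_sum_le _ _).trans_eq ?_))
      refine Finset.sum_congr rfl fun i _ => ?_
      rw [norm_mul, Complex.norm_real, Real.norm_eq_abs,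
        abs_of_nonneg (sub_nonneg.2 (min_le_left _ _))]
    have hsumi : ∀ i ∈ Finset.univ, Integrable (fun x => ‖a i‖ * (ℓ i x - b i x)) N :=
      fun i _ => ((hℓi (θ i)).sub (hbi i)).const_mul _
    calc ∫ x, G x ∂N ≤ ∫ x, (‖Complex.exp (w * x) - ∑ i, a i * ℓ i x‖ +
          ∑ i, ‖a i‖ * (ℓ i x - b i x)) ∂N :=
          integral_mono_of_nonneg (ae_of_all _ fun x => norm_nonneg _)
            (hHi.norm.add (integrable_finsetSum _ hsumi)) (ae_of_all _ hpt)
      _ = ∫ x, ‖Complex.exp (w * x) - ∑ i, a i * ℓ i x‖ ∂N +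
          ∑ i, ‖a i‖ * ∫ x, (ℓ i x - b i x) ∂N := by
          rw [integral_add hHi.norm (integrable_finsetSum _ hsumi), integral_finsetSum _ hsumi]
          simp_rw [integral_const_mul]
      _ ≤ ε + ∑ i, ‖a i‖ * δ := by
          refine add_le_add hc.le (Finset.sum_le_sum fun i _ => ?_)
          gcongr
          exact (hKN i).le
      _ ≤ 2 * ε := by rw [← Finset.sum_mul]; linarith
  have hGlim : Tendsto (fun n => ∫ ω, G (X n ω) ∂(P₀ n)) atTop (𝓝 (∫ x, G x ∂N)) := by
    refine (hweak.tendsto_integral hGc hGb).congr fun n => ?_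
    rw [integral_map (hX n).aemeasurable hGc.measurable.aestronglyMeasurable]
  set φ : Fin m → ℂ := fun i => ∫ x : ℝ, Complex.exp (-w * x) * (ℓ i x : ℝ) ∂N with hφ
  have hsumlim : Tendsto (fun n => ∑ i, a i * ∫ ω, f n ω ∂(P n (θ i))) atTop
      (𝓝 (∑ i, a i * φ i)) :=
    tendsto_finsetSum _ fun i _ => (hlim (θ i) (hθ i)).const_mul (a i)
  have hφ1 : ‖∑ i, a i * φ i - 1‖ ≤ ε := by
    have hi : ∀ i, Integrable (fun x : ℝ => Complex.exp (-w * x) * (ℓ i x : ℝ)) N := fun i =>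
      ((hℓi (θ i)).ofReal (𝕜 := ℂ)).bdd_mul (c := 1) (by fun_prop)
        (ae_of_all _ fun x => (hexp' x).le)
    have h1 : 1 - ∑ i, a i * φ i =
        ∫ x : ℝ, Complex.exp (-w * x) * (Complex.exp (w * x) - ∑ i, a i * ℓ i x) ∂N := by
      have h2 : ∀ x : ℝ, Complex.exp (-w * x) * (Complex.exp (w * x) - ∑ i, a i * ℓ i x) =
          1 - ∑ i, a i * (Complex.exp (-w * x) * (ℓ i x : ℝ)) := by
        intro x
        rw [mul_sub, ← Complex.exp_add, Finset.mul_sum]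
        congr 1
        · simp
        · exact Finset.sum_congr rfl fun i _ => by ring
      simp_rw [h2]
      rw [integral_sub (integrable_const _)
        (integrable_finsetSum _ fun i _ => (hi i).const_mul (a i)),
        integral_finsetSum _ fun i _ => (hi i).const_mul (a i)]
      simp_rw [integral_const_mul]
      simp [hφ]
    rw [norm_sub_rev, h1]
    refine (norm_integral_le_of_norm_le hHi.norm (ae_of_all _ fun x => ?_)).trans hc.le
    rw [norm_mul, hexp', one_mul]
  filter_upwards [hGlim.eventually (gt_mem_nhds (show ∫ x, G x ∂N < 3 * ε by linarith)),
    Metric.tendsto_nhds.1 hsumlim ε hε, eventually_all.2 hKn] with n hn1 hn2 hn3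
  have hfb : ∀ i, Integrable (fun ω => f n ω * (b i (X n ω) : ℝ)) (P₀ n) := fun i => by
    refine Integrable.of_bound
      ((hf n).mul (Complex.measurable_ofReal.comp ((hbc i).measurable.comp (hX n)))
        ).aestronglyMeasurable (K i) (ae_of_all _ fun ω => ?_)
    rw [norm_mul, Complex.norm_real, Real.norm_eq_abs]
    exact (mul_le_of_le_one_left (abs_nonneg _) (hf1 n ω)).trans (hbK i _)
  have hfe : Integrable (fun ω => f n ω * Complex.exp (w * X n ω)) (P₀ n) := by
    have hXn := hX n
    refine Integrable.of_bound ((hf n).mul (by fun_prop)).aestronglyMeasurable 1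
      (ae_of_all _ fun ω => ?_)
    rw [norm_mul, hexp, mul_one]
    exact hf1 n ω
  have hT1 : ‖∫ ω, f n ω * Complex.exp (w * X n ω) ∂(P₀ n) -
      ∑ i, a i * ∫ ω, f n ω * (b i (X n ω) : ℝ) ∂(P₀ n)‖ ≤ ∫ ω, G (X n ω) ∂(P₀ n) := by
    simp_rw [← integral_const_mul]
    rw [← integral_finsetSum _ fun i _ => (hfb i).const_mul (a i),
      ← integral_sub hfe (integrable_finsetSum _ fun i _ => (hfb i).const_mul (a i))]
    refine norm_integral_le_of_norm_le
      (Integrable.of_bound (hGc.measurable.comp (hX n)).aestronglyMeasurable _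
        (ae_of_all _ fun ω => hGb (X n ω))) (ae_of_all _ fun ω => ?_)
    have h1 : f n ω * Complex.exp (w * X n ω) - ∑ i, a i * (f n ω * (b i (X n ω) : ℝ)) =
        f n ω * (Complex.exp (w * X n ω) - ∑ i, a i * b i (X n ω)) := by
      rw [mul_sub, Finset.mul_sum]
      congr 1
      exact Finset.sum_congr rfl fun i _ => by ring
    rw [h1, norm_mul]
    exact mul_le_of_le_one_left (norm_nonneg _) (hf1 n ω)
  have hT2 : ‖∑ i, a i * ∫ ω, f n ω * (b i (X n ω) : ℝ) ∂(P₀ n) -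
      ∑ i, a i * ∫ ω, f n ω ∂(P n (θ i))‖ ≤ ε := by
    rw [← Finset.sum_sub_distrib]
    refine (norm_sum_le _ _).trans (le_trans ?_ hAδ)
    rw [hA, Finset.sum_mul]
    refine Finset.sum_le_sum fun i _ => ?_
    rw [← mul_sub, norm_mul, norm_sub_rev]
    gcongr
    exact hn3 i (f n) (hf n) (hf1 n)
  rw [dist_eq_norm] at hn2 ⊢
  have htri : ∀ x y z u : ℂ, ‖x - 1‖ ≤ ‖x - y‖ + ‖y - z‖ + ‖z - u‖ + ‖u - 1‖ := by
    intro x y z u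
    have h1 : x - 1 = (x - y) + (y - z) + (z - u) + (u - 1) := by ring
    rw [h1]
    exact (norm_add_le _ _).trans (add_le_add_left (norm_add₃_le) _)
  have hfinal := htri (∫ ω, f n ω * Complex.exp (w * X n ω) ∂(P₀ n))
    (∑ i, a i * ∫ ω, f n ω * (b i (X n ω) : ℝ) ∂(P₀ n))
    (∑ i, a i * ∫ ω, f n ω ∂(P n (θ i))) (∑ i, a i * φ i)
  linarith

lemma tendsto_measureReal_abs_gt_of_charFun {μ : ℕ → Measure ℝ} [∀ n, IsProbabilityMeasure (μ n)]
    (h : ∀ t : ℝ, Tendsto (fun n => charFun (μ n) t) atTop (𝓝 1)) {ε : ℝ} (hε : 0 < ε) :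
    Tendsto (fun n => (μ n).real {x | ε < |x|}) atTop (𝓝 0) := by
  have h1 : Tendsto (fun n => ∫ t in (-2 * ε⁻¹)..(2 * ε⁻¹), (1 - charFun (μ n) t)) atTop
      (𝓝 (∫ _ in (-2 * ε⁻¹)..(2 * ε⁻¹), (0 : ℂ))) := by
    refine intervalIntegral.tendsto_integral_filter_of_dominated_convergence (fun _ => 2)
      (Eventually.of_forall fun n => by fun_prop)
      (Eventually.of_forall fun n => ae_of_all _ fun t _ => ?_) (by simp)
      (ae_of_all _ fun t _ => by simpa using (h t).const_sub 1)
    exact norm_one_sub_charFun_le_two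
  have h2 := (h1.norm.const_mul (2⁻¹ * ε))
  simp only [intervalIntegral.integral_zero, norm_zero, mul_zero] at h2
  exact squeeze_zero (fun _ => measureReal_nonneg)
    (fun n => measureReal_abs_gt_le_integral_charFun hε) h2

lemma WeaklyTendsTo.tendsto_integral_cexp_comp {Ω : ℕ → Type*} [∀ n, MeasurableSpace (Ω n)]
    {P : (n : ℕ) → Measure (Ω n)} [∀ n, IsProbabilityMeasure (P n)] {X : (n : ℕ) → Ω n → ℝ}
    {N : Measure ℝ} [IsProbabilityMeasure N]
    (h : WeaklyTendsTo (fun n => (P n).map (X n)) N) (hX : ∀ n, Measurable (X n)) (t : ℝ) :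
    Tendsto (fun n => ∫ ω, Complex.exp (t * X n ω * Complex.I) ∂(P n)) atTop
      (𝓝 (charFun N t)) := by
  have := fun n => Measure.isProbabilityMeasure_map (μ := P n) (hX n).aemeasurable
  rw [charFun_apply_real]
  refine (h.tendsto_integral_complex (g := fun x : ℝ => Complex.exp (t * x * Complex.I))
    (by fun_prop) (C := 1) fun x => ?_).congr fun n => ?_
  · rw [← Complex.ofReal_mul, Complex.norm_exp_ofReal_mul_I]
  · rw [integral_map (hX n).aemeasurable (by fun_prop)]

/-- The characteristic functions of two sequences whose difference tends to `0` in probability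
have the same limits. -/
lemma tendsto_integral_cexp_sub_of_tendsto_measure {Ω : ℕ → Type*} [∀ n, MeasurableSpace (Ω n)]
    {P : (n : ℕ) → Measure (Ω n)} [∀ n, IsProbabilityMeasure (P n)] {Y Z : (n : ℕ) → Ω n → ℝ}
    (hY : ∀ n, Measurable (Y n)) (hZ : ∀ n, Measurable (Z n))
    (h : ∀ ε > 0, Tendsto (fun n => P n {ω | ε ≤ |Y n ω - Z n ω|}) atTop (𝓝 0)) (t : ℝ) :
    Tendsto (fun n => ∫ ω, Complex.exp (t * Y n ω * Complex.I) ∂(P n) -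
      ∫ ω, Complex.exp (t * Z n ω * Complex.I) ∂(P n)) atTop (𝓝 0) := by
  rw [Metric.tendsto_nhds]
  intro ε hε
  set η : ℝ := ε / (2 * (|t| + 1)) with hη_def
  have hη : 0 < η := by positivity
  have htη : |t| * η ≤ ε / 2 := by
    rw [hη_def, mul_div_assoc', div_le_div_iff₀ (by positivity) (by norm_num)]
    nlinarith [abs_nonneg t]
  have hreal := (ENNReal.tendsto_toReal ENNReal.zero_ne_top).comp (h η hη)
  rw [ENNReal.toReal_zero] at hreal
  filter_upwards [hreal.eventually (gt_mem_nhds (show (0 : ℝ) < ε / 4 by positivity))] with n hn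
  have hYn := hY n
  have hZn := hZ n
  have hA : MeasurableSet {ω | η ≤ |Y n ω - Z n ω|} :=
    measurableSet_le measurable_const (by fun_prop)
  have hint : ∀ W : Ω n → ℝ, Measurable W →
      Integrable (fun ω => Complex.exp (t * W ω * Complex.I)) (P n) := fun W hW =>
    Integrable.of_bound (by fun_prop) 1 (ae_of_all _ fun ω => by
      rw [← Complex.ofReal_mul, Complex.norm_exp_ofReal_mul_I])
  have hAi : Integrable ({ω | η ≤ |Y n ω - Z n ω|}.indicator fun _ => (1 : ℝ)) (P n) :=
    (integrable_const 1).indicator hA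
  rw [dist_zero_right, ← integral_sub (hint _ hYn) (hint _ hZn)]
  refine lt_of_le_of_lt (norm_integral_le_of_norm_le
    (((integrable_const (|t| * η)).add (hAi.const_mul 2))) (ae_of_all _ fun ω => ?_))
    (?_ : _ < ε)
  · simp only [Pi.add_apply]
    by_cases hω : ω ∈ {ω | η ≤ |Y n ω - Z n ω|}
    · rw [Set.indicator_of_mem hω]
      refine (norm_sub_le _ _).trans ?_
      rw [← Complex.ofReal_mul, ← Complex.ofReal_mul, Complex.norm_exp_ofReal_mul_I,
        Complex.norm_exp_ofReal_mul_I]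
      have : 0 ≤ |t| * η := by positivity
      linarith
    · rw [Set.indicator_of_notMem hω, mul_zero, add_zero]
      have hω' : |Y n ω - Z n ω| < η := not_le.1 hω
      have h1 : Complex.exp (t * Y n ω * Complex.I) - Complex.exp (t * Z n ω * Complex.I) =
          Complex.exp ((t * Z n ω : ℝ) * Complex.I) *
            (Complex.exp (Complex.I * (t * (Y n ω - Z n ω) : ℝ)) - 1) := by
        rw [mul_sub, ← Complex.exp_add, mul_one]
        push_cast
        congr 2
        ring
      rw [h1, norm_mul, Complex.norm_exp_ofReal_mul_I, one_mul]
      refine (Real.norm_exp_I_mul_ofReal_sub_one_le).trans ?_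
      rw [Real.norm_eq_abs, abs_mul]
      gcongr
  · rw [integral_add' (integrable_const _) (hAi.const_mul 2), integral_const_mul,
      integral_const_mul,
      integral_indicator_const _ hA]
    simp only [integral_const, probReal_univ, smul_eq_mul, one_mul, mul_one]
    have hn' : (P n).real {ω | η ≤ |Y n ω - Z n ω|} < ε / 4 := hn
    linarith

theorem stmt2
    (Θ : Set ℝ) (hΘ0 : (0 : ℝ) ∈ Θ) (hΘint : (interior (closure Θ)).Nonempty)
    (Ω : ℕ → Type*) [∀ n, MeasurableSpace (Ω n)]
    (P : (n : ℕ) → ℝ → Measure (Ω n))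
    (hP : ∀ n, ∀ θ ∈ Θ, IsProbabilityMeasure (P n θ))
    (σ : ℝ) (hσ : 0 < σ)
    (X : (n : ℕ) → Ω n → ℝ) (hX : ∀ n, Measurable (X n))
    -- LAN (i): the log-likelihood ratio expansion holds in `P n 0`-probability
    (hLAN : ∀ θ ∈ Θ, ∀ ε > 0,
      Tendsto (fun n => P n 0 {ω | ε ≤
          |Real.log ((P n θ).rnDeriv (P n 0) ω).toReal
            - (θ * X n ω - θ ^ 2 * σ ^ 2 / 2)|}) atTop (𝓝 0))
    -- LAN (ii): the central sequence is asymptotically `N(0, σ²)` under `P n 0`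
    (hCLT : WeaklyTendsTo (fun n => (P n 0).map (X n))
      (gaussianReal 0 ⟨σ ^ 2, sq_nonneg σ⟩))
    -- `S n` is a Θ-regular sequence of estimators with limit `Q`
    (S : (n : ℕ) → Ω n → ℝ) (hS : ∀ n, Measurable (S n))
    (Q : Measure ℝ) (hQ : IsProbabilityMeasure Q)
    (hreg : ∀ θ ∈ Θ, WeaklyTendsTo (fun n => (P n θ).map (S n)) (Q.map (· + θ))) :
    -- asymptotic efficiency  ↔  the limit law is Gaussian for at least one θ ∈ Θ
    (∀ ε > 0,
      Tendsto (fun n => P n 0 {ω | ε ≤ |S n ω - X n ω / σ ^ 2|}) atTop (𝓝 0))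
    ↔ ∃ θ ∈ Θ, Q.map (· + θ) = gaussianReal θ ⟨1 / σ ^ 2, by positivity⟩ := by
  have hP0 : ∀ n, IsProbabilityMeasure (P n 0) := fun n => hP n 0 hΘ0
  set v : NNReal := ⟨σ ^ 2, sq_nonneg σ⟩ with hv
  have hvσ : (v : ℝ) = σ ^ 2 := rfl
  have hv0 : v ≠ 0 := fun h => (pow_pos hσ 2).ne' (congrArg NNReal.toReal h)
  set u : NNReal := ⟨1 / σ ^ 2, by positivity⟩ with hu
  have huσ : (u : ℝ) = 1 / σ ^ 2 := rfl
  have hσC : (σ : ℂ) ≠ 0 := Complex.ofReal_ne_zero.2 hσ.ne'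
  have hQmap : ∀ θ, IsProbabilityMeasure (Q.map (· + θ)) := fun θ =>
    Measure.isProbabilityMeasure_map (by fun_prop)
  -- limits of the characteristic functions of `S n`
  have hSchar : ∀ θ ∈ Θ, ∀ t : ℝ, Tendsto
      (fun n => ∫ ω, Complex.exp (t * S n ω * Complex.I) ∂(P n θ)) atTop
      (𝓝 (charFun (Q.map (· + θ)) t)) := by
    intro θ hθ t
    have hPθ : ∀ n, IsProbabilityMeasure (P n θ) := fun n => hP n θ hθ
    have := fun n => Measure.isProbabilityMeasure_map (μ := P n θ) (hS n).aemeasurable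
    exact (hreg θ hθ).tendsto_integral_cexp_comp hS t
  constructor
  · intro heff
    refine ⟨0, hΘ0, ?_⟩
    have hXchar : ∀ t : ℝ, Tendsto
        (fun n => ∫ ω, Complex.exp (t * X n ω * Complex.I) ∂(P n 0)) atTop
        (𝓝 (charFun (gaussianReal 0 v) t)) := hCLT.tendsto_integral_cexp_comp hX
    refine Measure.ext_of_charFun (funext fun t => ?_)
    refine tendsto_nhds_unique (hSchar 0 hΘ0 t) ?_
    have hgauss : charFun (gaussianReal 0 u) t = charFun (gaussianReal 0 v) (t / σ ^ 2) := by
      rw [charFun_gaussianReal, charFun_gaussianReal, hvσ, huσ]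
      congr 1
      push_cast
      field_simp
      simp
    rw [hgauss]
    have hdiff := tendsto_integral_cexp_sub_of_tendsto_measure (P := fun n => P n 0) hS
      (fun n => (hX n).div_const (σ ^ 2)) heff t
    have := (hXchar (t / σ ^ 2)).add hdiff
    rw [add_zero] at this
    refine this.congr fun n => ?_
    rw [add_comm, sub_add_eq_add_sub]
    refine sub_eq_of_eq_add (congrArg _ (integral_congr_ae (ae_of_all _ fun ω => ?_)))
    beta_reduce
    congr 1
    push_cast
    ring
  · rintro ⟨θ₀, hθ₀, hQθ₀⟩
    have hQgauss : ∀ θ, Q.map (· + θ) = gaussianReal θ u := by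
      intro θ
      have h1 : Q.map (· + θ) = (Q.map (· + θ₀)).map (· + (θ - θ₀)) := by
        rw [Measure.map_map (by fun_prop) (by fun_prop)]
        congr 1
        funext x
        simp
      rw [h1, hQθ₀, gaussianReal_map_add_const, add_sub_cancel]
    have hlog : ∀ θ ∈ Θ, ∀ ε > 0, Tendsto (fun n => (P n 0).real
        {ω | ε ≤ |Real.log ((P n θ).rnDeriv (P n 0) ω).toReal
          - (θ * X n ω - θ ^ 2 * σ ^ 2 / 2)|}) atTop (𝓝 0) := fun θ hθ ε hε => by
      have := (ENNReal.tendsto_toReal ENNReal.zero_ne_top).comp (hLAN θ hθ ε hε)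
      rwa [ENNReal.toReal_zero] at this
    have hzero : ∀ θ ∈ Θ, Tendsto (fun n => (P n 0).real
        {ω | ((P n θ).rnDeriv (P n 0) ω).toReal = 0}) atTop (𝓝 0) := by
      intro θ hθ
      rcases eq_or_ne θ 0 with rfl | hne
      · refine tendsto_const_nhds.congr fun n => ?_
        rw [eq_comm, measureReal_eq_zero_iff, measure_eq_zero_iff_ae_notMem]
        filter_upwards [(P n 0).rnDeriv_self] with ω hω
        simp [hω]
      · refine tendsto_measureReal_eq_zero_of_log (P := fun n => P n 0)
          (Λ := fun x => θ * x - θ ^ 2 * σ ^ 2 / 2) hX hCLT (by fun_prop) ?_ (hlog θ hθ)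
        have := nullSingletonClass_gaussianReal (μ := 0) hv0
        have h1 : ∀ᵐ x ∂(gaussianReal 0 v), x ≠ θ * σ ^ 2 / 2 := by
          rw [ae_iff]; simp
        filter_upwards [h1] with x hx h
        refine hx (mul_left_cancel₀ hne ?_)
        linarith
    have hNexp : ∀ r : ℝ, Integrable (fun x => Real.exp (r * x)) (gaussianReal 0 v) := fun r =>
      integrable_exp_mul_gaussianReal r
    have hmgf : ∀ z : ℂ, ∀ θ : ℝ, ∫ x : ℝ, Complex.exp (z * x) *
        (Real.exp (θ * x - θ ^ 2 * σ ^ 2 / 2) : ℝ) ∂(gaussianReal 0 v) =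
          Complex.exp (σ ^ 2 * (z + θ) ^ 2 / 2 - θ ^ 2 * σ ^ 2 / 2) := by
      intro z θ
      have h1 : ∀ x : ℝ, Complex.exp (z * x) * (Real.exp (θ * x - θ ^ 2 * σ ^ 2 / 2) : ℝ) =
          Complex.exp ((z + θ) * x) * Complex.exp (-(θ ^ 2 * σ ^ 2 / 2)) := by
        intro x
        push_cast
        rw [← Complex.exp_add, ← Complex.exp_add]
        congr 1
        ring
      have h2 := complexMGF_id_gaussianReal (μ := 0) (v := v) (z + θ)
      rw [complexMGF] at h2
      simp only [id] at h2
      simp_rw [h1]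
      rw [integral_mul_const, h2, ← Complex.exp_add, hvσ]
      congr 1
      push_cast
      ring
    have hone : ∀ θ : ℝ,
        ∫ x, Real.exp (θ * x - θ ^ 2 * σ ^ 2 / 2) ∂(gaussianReal 0 v) = 1 := by
      intro θ
      have h1 := hmgf 0 θ
      simp only [zero_mul, Complex.exp_zero, one_mul, zero_add] at h1
      rw [integral_complex_ofReal, mul_comm ((θ : ℂ) ^ 2), sub_self,
        Complex.exp_zero] at h1
      exact_mod_cast h1
    have hD : ∀ n, Measurable fun ω => S n ω - X n ω / σ ^ 2 := fun n =>
      (hS n).sub ((hX n).div_const _)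
    have hchar : ∀ t : ℝ, Tendsto (fun n => charFun ((P n 0).map
        fun ω => S n ω - X n ω / σ ^ 2) t) atTop (𝓝 1) := by
      intro t
      have h1 := tendsto_integral_mul_cexp_one (P := P) (P₀ := fun n => P n 0) hX hNexp hCLT hΘint
        (κ := fun θ => θ ^ 2 * σ ^ 2 / 2) ?_ (w := (-(t / σ ^ 2) : ℝ) * Complex.I)
        (by rw [Complex.re_ofReal_mul, Complex.I_re, mul_zero])
        (f := fun n ω => Complex.exp (t * S n ω * Complex.I)) ?_ ?_ ?_
      · refine h1.congr fun n => ?_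
        rw [charFun_apply_real, integral_map (hD n).aemeasurable (by fun_prop)]
        refine integral_congr_ae (ae_of_all _ fun ω => ?_)
        simp only [← Complex.exp_add]
        congr 1
        push_cast
        ring
      · intro θ hθ δ hδ
        have hPθ : ∀ n, IsProbabilityMeasure (P n θ) := fun n => hP n θ hθ
        refine exists_truncated_density (P := fun n => P n 0) (ν := fun n => P n θ)
          (Λ := fun x => θ * x - θ ^ 2 * σ ^ 2 / 2) hX hCLT (by fun_prop) ?_ (hone θ)
          (hlog θ hθ) (hzero θ hθ) hδ
        simp_rw [Real.exp_sub]
        exact (hNexp θ).div_const _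
      · intro n
        have := hS n
        fun_prop
      · intro n ω
        rw [← Complex.ofReal_mul, Complex.norm_exp_ofReal_mul_I]
      · intro θ hθ
        have h2 := hSchar θ hθ t
        rw [hQgauss, charFun_gaussianReal, huσ] at h2
        rw [hmgf]
        convert h2 using 3
        push_cast
        field_simp
        ring_nf
        simp only [Complex.I_sq]
        ring
    intro ε hε
    have := fun n => Measure.isProbabilityMeasure_map (μ := P n 0) (hD n).aemeasurable
    have htail := tendsto_measureReal_abs_gt_of_charFun hchar (half_pos hε)
    rw [← ENNReal.tendsto_toReal_iff (fun n => measure_ne_top _ _) ENNReal.zero_ne_top,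
      ENNReal.toReal_zero]
    refine squeeze_zero (fun _ => ENNReal.toReal_nonneg) (fun n => ?_) htail
    rw [map_measureReal_apply (hD n) (measurableSet_lt measurable_const (by fun_prop))]
    refine measureReal_mono fun ω hω => ?_
    have hω' : ε ≤ |S n ω - X n ω / σ ^ 2| := hω
    show ε / 2 < |S n ω - X n ω / σ ^ 2|
    linarith
end

section
/- Assume Θ₁ ⊆ Θ satisfies Θ₁ + Θ₁ ⊆ Θ and the family {P ∗ ε_{h(θ)} : θ ∈ Θ₁} is boundedly complete. Then the law of Π₂ − f(Π₁) under μ_θ is the same for all θ ∈ Θ₁ (i.e. Π₂ − f(Π₁) is ancillary with respect to Θ₁), and moreover for every θ ∈ Θ₁ the random elements Π₁ and Π₂ − f(Π₁) are independent under μ_θ. -/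
open MeasureTheory ProbabilityTheory

/-- A family of measures indexed by `S` is boundedly complete. -/
def IsBoundedlyComplete {ι V : Type*} [MeasurableSpace V] (M : ι → Measure V) (S : Set ι) : Prop :=
  ∀ φ : V → ℝ, Measurable φ → (∃ C, ∀ x, |φ x| ≤ C) →
    (∀ θ ∈ S, ∫ x, φ x ∂(M θ) = 0) → ∀ θ ∈ S, φ =ᵐ[M θ] 0

section BoundedlyComplete

variable {ι V W : Type*} [MeasurableSpace V] [MeasurableSpace W]
  {M : ι → Measure V} [∀ i, IsProbabilityMeasure (M i)] {S : Set ι}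

lemma IsBoundedlyComplete.ae_eq_of_lintegral_eq (hM : IsBoundedlyComplete M S)
    {a b : V → ENNReal} (ha : Measurable a) (hb : Measurable b) (ha1 : ∀ x, a x ≤ 1)
    (hb1 : ∀ x, b x ≤ 1) (hab : ∀ θ ∈ S, ∫⁻ x, a x ∂(M θ) = ∫⁻ x, b x ∂(M θ)) :
    ∀ θ ∈ S, a =ᵐ[M θ] b := by
  have toReal_le {c : V → ENNReal} (hc : ∀ x, c x ≤ 1) (x : V) : (c x).toReal ≤ 1 :=
    ENNReal.toReal_le_of_le_ofReal zero_le_one (by simpa using hc x)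
  have integrable {c : V → ENNReal} (hcm : Measurable c) (hc : ∀ x, c x ≤ 1) (θ : ι) :
      Integrable (fun x => (c x).toReal) (M θ) :=
    Integrable.of_bound hcm.ennreal_toReal.aestronglyMeasurable 1
      (.of_forall fun x => by simpa using toReal_le hc x)
  have lt_top {c : V → ENNReal} (hc : ∀ x, c x ≤ 1) (x : V) : c x < ⊤ :=
    (hc x).trans_lt ENNReal.one_lt_top
  intro θ hθ
  have key := hM (fun x => (a x).toReal - (b x).toReal)
    (ha.ennreal_toReal.sub hb.ennreal_toReal)
    ⟨1, fun x => abs_le.2 ⟨by linarith [toReal_le hb1 x, (a x).toReal_nonneg],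
      by linarith [toReal_le ha1 x, (b x).toReal_nonneg]⟩⟩
    (fun θ hθ => by
      rw [integral_sub (integrable ha ha1 θ) (integrable hb hb1 θ),
        integral_toReal ha.aemeasurable (.of_forall (lt_top ha1)),
        integral_toReal hb.aemeasurable (.of_forall (lt_top hb1)), hab θ hθ, sub_self]) θ hθ
  filter_upwards [key] with x hx
  exact (ENNReal.toReal_eq_toReal_iff' (lt_top ha1 x).ne (lt_top hb1 x).ne).1 (sub_eq_zero.1 hx)

lemma IsBoundedlyComplete.kernel_ae_eq_of_bind_eq [MeasurableSpace.CountablyGenerated W]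
    (hM : IsBoundedlyComplete M S)
    {κ η : Kernel V W} [IsMarkovKernel κ] [IsMarkovKernel η]
    (hκη : ∀ θ ∈ S, (M θ).bind κ = (M θ).bind η) :
    ∀ θ ∈ S, κ =ᵐ[M θ] η := by
  intro θ hθ
  refine Kernel.ae_eq_of_compProd_eq (Measure.ext_prod fun {s t} hs ht => ?_)
  rw [Measure.compProd_apply_prod hs ht, Measure.compProd_apply_prod hs ht]
  refine lintegral_congr_ae (ae_restrict_of_ae ?_)
  refine hM.ae_eq_of_lintegral_eq (κ.measurable_coe ht) (η.measurable_coe ht)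
    (fun _ => prob_le_one) (fun _ => prob_le_one) (fun θ hθ => ?_) θ hθ
  rw [← Measure.bind_apply ht κ.aemeasurable, ← Measure.bind_apply ht η.aemeasurable, hκη θ hθ]

end BoundedlyComplete

/-- The law of `w - f x` for `w` distributed according to `K x`. -/
noncomputable def residualKernel {V W : Type*} [MeasurableSpace V] [MeasurableSpace W] [Sub W]
    (K : Kernel V W) (f : V → W) : Kernel V W :=
  (Kernel.id ×ₖ K).map (fun p => p.2 - f p.1)

section Residual

variable {V W : Type*} [MeasurableSpace V] [MeasurableSpace W]
  {K : Kernel V W} [IsMarkovKernel K] {f : V → W}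

lemma measurable_residual [Sub W] [MeasurableSub₂ W] (hf : Measurable f) :
    Measurable (fun p : V × W => p.2 - f p.1) :=
  measurable_snd.sub (hf.comp measurable_fst)

lemma isMarkovKernel_residualKernel [Sub W] [MeasurableSub₂ W] (hf : Measurable f) :
    IsMarkovKernel (residualKernel K f) :=
  Kernel.IsMarkovKernel.map _ (measurable_residual hf)

lemma residualKernel_apply [Sub W] [MeasurableSub₂ W] (hf : Measurable f) (x : V) :
    residualKernel K f x = (K x).map (fun w => w - f x) := by
  rw [residualKernel, Kernel.map_apply _ (measurable_residual hf), Kernel.prod_apply,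
    Kernel.id_apply, Measure.dirac_prod, Measure.map_map (measurable_residual hf) (by fun_prop)]
  rfl

lemma map_compProd_residual [Sub W] [MeasurableSub₂ W] (hf : Measurable f)
    (μ : Measure V) [IsProbabilityMeasure μ] :
    (μ ⊗ₘ K).map (fun p => (p.1, p.2 - f p.1)) = μ ⊗ₘ residualKernel K f := by
  have := isMarkovKernel_residualKernel (K := K) hf
  have hm : Measurable (fun p : V × W => (p.1, p.2 - f p.1)) :=
    measurable_fst.prodMk (measurable_residual hf)
  ext s hs
  rw [Measure.map_apply hm hs, Measure.compProd_apply (hm hs), Measure.compProd_apply hs]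
  refine lintegral_congr fun x => ?_
  rw [residualKernel_apply hf, Measure.map_apply (by fun_prop) (measurable_prodMk_left hs)]
  rfl

lemma map_residual_compProd [Sub W] [MeasurableSub₂ W] (hf : Measurable f)
    (μ : Measure V) [IsProbabilityMeasure μ] :
    (μ ⊗ₘ K).map (fun p => p.2 - f p.1) = μ.bind (residualKernel K f) := by
  have := isMarkovKernel_residualKernel (K := K) hf
  rw [← Measure.snd_compProd, ← map_compProd_residual hf, Measure.snd,
    Measure.map_map measurable_snd (measurable_fst.prodMk (measurable_residual hf))]
  rfl

lemma map_bind_eq_bind_comap {μ : Measure V} {T : V → V} (hT : Measurable T) (κ : Kernel V W) :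
    (μ.map T).bind κ = μ.bind (κ.comap T hT) := by
  ext s hs
  rw [Measure.bind_apply hs κ.aemeasurable, Measure.bind_apply hs (Kernel.aemeasurable _),
    lintegral_map (κ.measurable_coe hs) hT]
  rfl

end Residual

/-- Ancillarity and independence in the limit experiment (Theorem 2.3 (a)). -/
theorem stmt6
    {V : Type*} [AddCommGroup V] [MeasurableSpace V] [MeasurableAdd₂ V] [MeasurableNeg V]
    {W : Type*} [AddCommGroup W] [MeasurableSpace W] [MeasurableAdd₂ W] [MeasurableNeg W]
    [MeasurableSub₂ W] [StandardBorelSpace W]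
    {V₀ : Type*} [AddCommGroup V₀]
    (h : V₀ →+ V) (hinj : Function.Injective h)
    (f : V →+ W) (hf : Measurable f)
    (Θ : Set V₀)
    (P : Measure V) [IsProbabilityMeasure P]
    (Q : Measure W) [IsProbabilityMeasure Q]
    (K : Kernel V W) [IsMarkovKernel K]
    -- `Q ∗ ε_{g θ}` is the image of `P ∗ ε_{h θ}` under the kernel `K`
    (hK : ∀ θ ∈ Θ, Q.map (· + f (h θ)) = (P.map (· + h θ)).bind (fun x => K x))
    (Θ₁ : Set V₀) (hΘ₁ : Θ₁ ⊆ Θ) (hΘ₁add : ∀ θ ∈ Θ₁, ∀ τ ∈ Θ₁, θ + τ ∈ Θ)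
    -- bounded completeness of `{P ∗ ε_{h θ} : θ ∈ Θ₁}`
    (hcomplete : ∀ φ : V → ℝ, Measurable φ → (∃ C, ∀ x, |φ x| ≤ C) →
      (∀ θ ∈ Θ₁, ∫ x, φ x ∂(P.map (· + h θ)) = 0) →
      ∀ θ ∈ Θ₁, φ =ᵐ[P.map (· + h θ)] 0) :
    -- `Π₂ - f(Π₁)` is ancillary w.r.t. `Θ₁` …
    (∀ θ ∈ Θ₁, ∀ τ ∈ Θ₁,
      ((P.map (· + h θ)) ⊗ₘ K).map (fun p => p.2 - f p.1)
        = ((P.map (· + h τ)) ⊗ₘ K).map (fun p => p.2 - f p.1))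
    -- … and `Π₁` and `Π₂ - f(Π₁)` are independent under `μ_θ` for every `θ ∈ Θ₁`
    ∧ ∀ θ ∈ Θ₁,
      IndepFun (fun p : V × W => p.1) (fun p : V × W => p.2 - f p.1)
        ((P.map (· + h θ)) ⊗ₘ K) := by
  have hadd (v : V) : Measurable (· + v) := measurable_add_const v
  have hsub (w : W) : Measurable (· - w) := measurable_id.sub_const w
  have hprob (θ : V₀) : IsProbabilityMeasure (P.map (· + h θ)) :=
    Measure.isProbabilityMeasure_map (hadd _).aemeasurable
  have hM : IsBoundedlyComplete (fun θ => P.map (· + h θ)) Θ₁ := hcomplete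
  have hshift (θ τ : V₀) : P.map (· + h (θ + τ)) = (P.map (· + h θ)).map (· + h τ) := by
    rw [Measure.map_map (hadd _) (hadd _)]
    congr 1
    ext x
    simp [add_assoc]
  have := isMarkovKernel_residualKernel (K := K) hf
  -- the kernel `K` is equivariant under the shifts
  have hequi : ∀ τ ∈ Θ₁, ∀ θ ∈ Θ₁, ∀ᵐ x ∂(P.map (· + h θ)),
      K x = (K (x + h τ)).map (fun w => w - f (h τ)) := by
    intro τ hτ θ hθ
    have : IsMarkovKernel ((K.comap (· + h τ) (hadd _)).map (fun w => w - f (h τ))) :=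
      Kernel.IsMarkovKernel.map _ (hsub _)
    have key := hM.kernel_ae_eq_of_bind_eq (κ := K)
      (η := (K.comap (· + h τ) (hadd _)).map (fun w => w - f (h τ))) (fun θ hθ => by
        rw [← Measure.map_comp _ _ (hsub _), ← map_bind_eq_bind_comap, ← hshift,
          ← hK θ (hΘ₁ hθ), ← hK (θ + τ) (hΘ₁add θ hθ τ hτ),
          Measure.map_map (hsub _) (measurable_add_const _)]
        congr 1
        ext x
        simp [← add_assoc]) θ hθ
    filter_upwards [key] with x hx
    rw [hx, Kernel.map_apply _ (hsub _), Kernel.comap_apply]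
  have hinv (θ : V₀) (hθ : θ ∈ Θ₁) (τ : V₀) (hτ : τ ∈ Θ₁) :
      (P.map (· + h (θ + τ))).bind (residualKernel K f)
        = (P.map (· + h θ)).bind (residualKernel K f) := by
    rw [hshift, map_bind_eq_bind_comap (hadd _)]
    refine Measure.bind_congr_right ?_
    filter_upwards [hequi τ hτ θ hθ] with x hx
    rw [Kernel.comap_apply, residualKernel_apply hf, residualKernel_apply hf, hx,
      Measure.map_map (hsub _) (hsub _)]
    congr 1
    ext w
    simp [sub_sub, add_comm]
  have hanc (θ : V₀) (hθ : θ ∈ Θ₁) (τ : V₀) (hτ : τ ∈ Θ₁) :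
      (P.map (· + h θ)).bind (residualKernel K f)
        = (P.map (· + h τ)).bind (residualKernel K f) := by
    rw [← hinv θ hθ τ hτ, add_comm, hinv τ hτ θ hθ]
  refine ⟨fun θ hθ τ hτ => ?_, fun θ hθ => ?_⟩
  · rw [map_residual_compProd hf, map_residual_compProd hf, hanc θ hθ τ hτ]
  · have hconst := hM.kernel_ae_eq_of_bind_eq (κ := residualKernel K f)
      (η := Kernel.const V ((P.map (· + h θ)).bind (residualKernel K f)))
      (fun τ hτ => by rw [Measure.const_comp, measure_univ, one_smul, hanc τ hτ θ hθ]) θ hθ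
    rw [indepFun_iff_map_prod_eq_prod_map_map measurable_fst.aemeasurable
      (measurable_residual hf).aemeasurable, map_compProd_residual hf, map_residual_compProd hf,
      Measure.compProd_congr hconst, Measure.compProd_const]
    congr 1
    exact (Measure.fst_compProd _ _).symm
end

section
/- Assume Θ₁ ⊆ Θ satisfies Θ₁ + Θ₁ ⊆ Θ and the family {P ∗ ε_{h(θ)} : θ ∈ Θ₁} is boundedly complete. Then for all θ, τ ∈ Θ₁ the kernel is shift-equivariant almost everywhere: K(x, ·) = K(x + h(θ), ·) ∗ ε_{−g(θ)} for (P ∗ ε_{h(τ)})-almost every x ∈ V, i.e. K(x, B) = K(x + h(θ), B + g(θ)) for all measurable B ⊆ W, for (P ∗ ε_{h(τ)})-almost every x. -/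
open MeasureTheory ProbabilityTheory

/-- Two Markov kernels into a countably generated space coincide almost everywhere as soon as, for
each measurable set, their values on that set coincide almost everywhere. -/
theorem kernel_ae_eq_of_forall_measurableSet {X Y : Type*} [MeasurableSpace X] [MeasurableSpace Y]
    [MeasurableSpace.CountablyGenerated Y] (μ : Measure X) [IsProbabilityMeasure μ]
    (κ η : Kernel X Y) [IsMarkovKernel κ] [IsMarkovKernel η]
    (hκη : ∀ B, MeasurableSet B → ∀ᵐ x ∂μ, κ x B = η x B) : κ =ᵐ[μ] η := by
  refine Kernel.ae_eq_of_compProd_eq (Measure.ext_prod fun {s t} hs ht => ?_)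
  rw [Measure.compProd_apply_prod hs ht, Measure.compProd_apply_prod hs ht]
  exact lintegral_congr_ae (ae_restrict_of_ae (hκη t ht))

/-- The mean of the real-valued mass a Markov kernel gives to a set is the mass of that set under
the image measure. -/
theorem integral_kernel_real_eq_bind_real {X Y : Type*} [MeasurableSpace X] [MeasurableSpace Y]
    (μ : Measure X) (κ : Kernel X Y) [IsMarkovKernel κ] {B : Set Y} (hB : MeasurableSet B) :
    ∫ x, (κ x).real B ∂μ = (μ.bind κ).real B := by
  simp only [measureReal_def]
  rw [Measure.bind_apply hB κ.aemeasurable,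
    integral_toReal (κ.measurable_coe hB).aemeasurable (ae_of_all _ fun x => measure_lt_top _ _)]

/-- Almost everywhere shift-equivariance of the kernel (step (2.10) in the proof of the
convolution theorem for limit experiments). -/
theorem stmt8
    {V : Type*} [AddCommGroup V] [MeasurableSpace V] [MeasurableAdd₂ V] [MeasurableNeg V]
    {W : Type*} [AddCommGroup W] [MeasurableSpace W] [MeasurableAdd₂ W] [MeasurableNeg W]
    [MeasurableSub₂ W] [StandardBorelSpace W]
    {V₀ : Type*} [AddCommGroup V₀]
    (h : V₀ →+ V) (hinj : Function.Injective h)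
    (f : V →+ W) (hf : Measurable f)
    (Θ : Set V₀)
    (P : Measure V) [IsProbabilityMeasure P]
    (Q : Measure W) [IsProbabilityMeasure Q]
    (K : Kernel V W) [IsMarkovKernel K]
    -- `Q ∗ ε_{g θ}` is the image of `P ∗ ε_{h θ}` under the kernel `K`
    (hK : ∀ θ ∈ Θ, Q.map (· + f (h θ)) = (P.map (· + h θ)).bind (fun x => K x))
    (Θ₁ : Set V₀) (hΘ₁ : Θ₁ ⊆ Θ)
    (hΘ₁add : ∀ θ ∈ Θ₁, ∀ τ ∈ Θ₁, θ + τ ∈ Θ)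
    -- bounded completeness of `{P ∗ ε_{h θ} : θ ∈ Θ₁}`
    (hcomplete : ∀ φ : V → ℝ, Measurable φ → (∃ C, ∀ x, |φ x| ≤ C) →
      (∀ θ ∈ Θ₁, ∫ x, φ x ∂(P.map (· + h θ)) = 0) →
      ∀ θ ∈ Θ₁, φ =ᵐ[P.map (· + h θ)] 0) :
    -- a.e. shift-equivariance: `K(x, ·) = K(x + h θ, ·) ∗ ε_{-g θ}`
    ∀ θ ∈ Θ₁, ∀ τ ∈ Θ₁,
      ∀ᵐ x ∂(P.map (· + h τ)),
        (K x : Measure W) = (K (x + h θ)).map (fun w => w - f (h θ)) := by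
  intro θ hθ τ hτ
  have hadd : Measurable (fun x : V => x + h θ) := measurable_add_const _
  have hsub : Measurable (fun w : W => w - f (h θ)) := measurable_sub_const _
  have hprob : ∀ σ, IsProbabilityMeasure (P.map (· + h σ)) := fun σ =>
    Measure.isProbabilityMeasure_map (measurable_add_const _).aemeasurable
  let K' : Kernel V W := (K.comap _ hadd).map (fun w => w - f (h θ))
  have hK'_apply : ∀ x, K' x = (K (x + h θ)).map (fun w => w - f (h θ)) := fun x => by
    rw [Kernel.map_apply _ hsub, Kernel.comap_apply]
  have : IsMarkovKernel K' := Kernel.IsMarkovKernel.map _ hsub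
  have hbind : ∀ σ ∈ Θ₁, (P.map (· + h σ)).bind K' = (P.map (· + h σ)).bind K := by
    intro σ hσ
    have hsum : (P.map (· + h σ)).map (· + h θ) = P.map (· + h (σ + θ)) := by
      rw [Measure.map_map hadd (measurable_add_const _)]
      congr 1
      ext x
      simp [add_assoc]
    have hshift : (P.map (· + h σ)).bind K' =
        ((P.map (· + h (σ + θ))).bind K).map (fun w => w - f (h θ)) := by
      ext B hB
      rw [Measure.bind_apply hB K'.aemeasurable, Measure.map_apply hsub hB,
        Measure.bind_apply (hsub hB) K.aemeasurable, ← hsum,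
        lintegral_map (K.measurable_coe (hsub hB)) hadd]
      simp_rw [hK'_apply, Measure.map_apply hsub hB]
    rw [hshift, ← hK _ (hΘ₁add σ hσ θ hθ), ← hK σ (hΘ₁ hσ),
      Measure.map_map hsub (measurable_add_const _)]
    congr 1
    ext w
    simp [← add_assoc]
  have key : K =ᵐ[P.map (· + h τ)] K' := by
    have := hprob τ
    refine kernel_ae_eq_of_forall_measurableSet _ K K' fun B hB => ?_
    have hm : ∀ κ : Kernel V W, Measurable fun x => (κ x).real B := fun κ =>
      (κ.measurable_coe hB).ennreal_toReal
    have hzero := hcomplete (fun x => (K x).real B - (K' x).real B) ((hm K).sub (hm K'))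
      ⟨1, fun x => abs_sub_le_of_nonneg_of_le measureReal_nonneg measureReal_le_one
        measureReal_nonneg measureReal_le_one⟩ (fun σ hσ => ?_) τ hτ
    · filter_upwards [hzero] with x hx
      exact (measureReal_eq_measureReal_iff).1 (sub_eq_zero.1 hx)
    · have := hprob σ
      have hint : ∀ κ : Kernel V W, IsMarkovKernel κ →
          Integrable (fun x => (κ x).real B) (P.map (· + h σ)) := fun κ _ =>
        .of_bound (hm κ).aestronglyMeasurable 1 (ae_of_all _ fun x => by
          simp [abs_of_nonneg measureReal_nonneg])
      rw [integral_sub (hint K inferInstance) (hint K' inferInstance),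
        integral_kernel_real_eq_bind_real _ K hB, integral_kernel_real_eq_bind_real _ K' hB,
        hbind σ hσ, sub_self]
  filter_upwards [key] with x hx
  rw [hx, hK'_apply]
end

section
/- Let 𝒜_n ⊆ 𝒜_{n+1} ⊆ 𝒜 be an increasing sequence of sub-σ-fields of a measurable space (Ω, 𝒜) and set 𝒜₀ := σ(⋃_n 𝒜_n). Let Θ_n ⊆ Θ_{n+1} ⊆ Θ be increasing parameter sets and {P_θ : θ ∈ Θ} probability measures on (Ω, 𝒜). Assume: (i) for each n, 𝒜_n is sufficient for {P_θ : θ ∈ Θ_n}, i.e. for every bounded 𝒜-measurable f : Ω → ℝ there exists a bounded 𝒜_n-measurable f_n which is a version of the conditional expectation E_{P_θ}[f | 𝒜_n] simultaneously for all θ ∈ Θ_n; (ii) for each n, 𝒜_n is boundedly complete with respect to {P_θ : θ ∈ Θ_n}, i.e. every bounded 𝒜_n-measurable g with ∫ g dP_θ = 0 for all θ ∈ Θ_n satisfies g = 0 P_θ-a.e. for all θ ∈ Θ_n; (iii) the family {P_θ : θ ∈ Θ} is dominated by {P_θ : θ ∈ ⋃_n Θ_n}, i.e. every 𝒜-measurable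 set which is P_θ-null for all θ ∈ ⋃_n Θ_n is P_θ-null for all θ ∈ Θ. Then 𝒜₀ is boundedly complete with respect to {P_θ : θ ∈ Θ}: every bounded 𝒜₀-measurable f with ∫ f dP_θ = 0 for all θ ∈ Θ satisfies f = 0 P_θ-a.e. for all θ ∈ Θ. -/
open MeasureTheory Filter

/-- Bounded completeness of the limit σ-field of an increasing sequence of sufficient and
boundedly complete σ-fields (Lemma 2.3 / Lemma 3.3 of the paper). -/
theorem stmt9 {Ω : Type*} {mΩ : MeasurableSpace Ω}
    (A : ℕ → MeasurableSpace Ω) (hA_le : ∀ n, A n ≤ mΩ) (hA_mono : Monotone A)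
    {ι : Type*} (Θn : ℕ → Set ι) (hΘ_mono : Monotone Θn)
    (P : ι → Measure Ω) (hP : ∀ θ, IsProbabilityMeasure (P θ))
    -- (i) sufficiency of `A n` for `{P θ : θ ∈ Θn n}`: a common version of the
    -- conditional expectation exists for every bounded measurable function
    (hsuff : ∀ n, ∀ f : Ω → ℝ, Measurable f → (∃ C, ∀ ω, |f ω| ≤ C) →
      ∃ fn : Ω → ℝ, Measurable[A n] fn ∧ (∃ C, ∀ ω, |fn ω| ≤ C) ∧
        ∀ θ ∈ Θn n, fn =ᵐ[P θ] (P θ)[f | A n])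
    -- (ii) bounded completeness of `A n` w.r.t. `{P θ : θ ∈ Θn n}`
    (hcompl : ∀ n, ∀ g : Ω → ℝ, Measurable[A n] g → (∃ C, ∀ ω, |g ω| ≤ C) →
      (∀ θ ∈ Θn n, ∫ ω, g ω ∂(P θ) = 0) → ∀ θ ∈ Θn n, g =ᵐ[P θ] 0)
    -- (iii) `{P θ : θ ∈ Θ}` is dominated by `{P θ : θ ∈ ⋃ n, Θn n}`
    (hdom : ∀ N : Set Ω, MeasurableSet N → (∀ n, ∀ θ ∈ Θn n, P θ N = 0) →
      ∀ θ, P θ N = 0) :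
    -- `𝒜₀ = σ(⋃ n, A n) = ⨆ n, A n` is boundedly complete w.r.t. `{P θ : θ ∈ Θ}`
    ∀ f : Ω → ℝ, Measurable[⨆ n, A n] f → (∃ C, ∀ ω, |f ω| ≤ C) →
      (∀ θ, ∫ ω, f ω ∂(P θ) = 0) → ∀ θ, f =ᵐ[P θ] 0 := by
  intro f hf hfb hf0
  have hsup_le : ⨆ n, A n ≤ mΩ := iSup_le hA_le
  have hfm : Measurable f := hf.mono hsup_le le_rfl
  have hint : ∀ θ, Integrable f (P θ) := fun θ => by
    obtain ⟨C, hC⟩ := hfb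
    have := hP θ
    exact Integrable.of_bound hfm.aestronglyMeasurable C (Eventually.of_forall hC)
  have hcond : ∀ n, ∀ θ ∈ Θn n, (P θ)[f | A n] =ᵐ[P θ] 0 := fun n θ hθ => by
    obtain ⟨fn, hfn, hfnb, hfne⟩ := hsuff n f hfm hfb
    refine (hfne θ hθ).symm.trans (hcompl n fn hfn hfnb (fun θ' hθ' => ?_) θ hθ)
    have := hP θ'
    rw [integral_congr_ae (hfne θ' hθ'), integral_condExp (hA_le n), hf0 θ']
  let ℱ : Filtration ℕ mΩ := ⟨A, hA_mono, hA_le⟩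
  have hzero : ∀ m, ∀ θ ∈ Θn m, f =ᵐ[P θ] 0 := fun m θ hθ => by
    have := hP θ
    have hlim : ∀ᵐ ω ∂(P θ), Tendsto (fun n => ((P θ)[f | A n]) ω) atTop (nhds (f ω)) :=
      (hint θ).tendsto_ae_condExp (ℱ := ℱ) hf.stronglyMeasurable
    have hev : ∀ᵐ ω ∂(P θ), ∀ n, m ≤ n → ((P θ)[f | A n]) ω = 0 :=
      ae_all_iff.2 fun n => by
        by_cases hmn : m ≤ n
        · filter_upwards [hcond n θ (hΘ_mono hmn hθ)] with ω hω _ using hω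
        · exact Eventually.of_forall fun ω h => absurd h hmn
    filter_upwards [hlim, hev] with ω hω hω0
    exact tendsto_nhds_unique hω
      (tendsto_const_nhds.congr' ((eventually_ge_atTop m).mono fun n hn => (hω0 n hn).symm))
  have hN : MeasurableSet {ω | ¬ f ω = 0} := (hfm (measurableSet_singleton 0)).compl
  exact fun θ => ae_iff.2 (hdom _ hN (fun n θ' hθ' => ae_iff.1 (hzero n θ' hθ')) θ)
end

section
/- Let P be a probability measure on ℝ^d which is absolutely continuous with respect to Lebesgue measure and whose characteristic function φ_P(t) = ∫ exp(i⟨t, x⟩) dP(x) is nonzero for every t ∈ ℝ^d, and let Θ ⊆ ℝ^d be dense. Then the shift family {P ∗ ε_θ : θ ∈ Θ} is boundedly complete: every bounded measurable φ : ℝ^d → ℝ satisfying ∫ φ d(P ∗ ε_θ) = 0 for all θ ∈ Θ satisfies φ = 0 (P ∗ ε_θ)-almost everywhere for every θ ∈ ℝ^d. -/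
open MeasureTheory
open scoped FourierTransform Topology ContDiff

section
variable {V : Type*} [NormedAddCommGroup V] [InnerProductSpace ℝ V] [FiniteDimensional ℝ V]
  [MeasurableSpace V] [BorelSpace V]

/-- Translation is continuous in `L¹`. -/
theorem continuous_integral_norm_translate_sub {E : Type*} [NormedAddCommGroup E]
    {f : V → E} (hf : Integrable f) :
    Continuous fun z : V ↦ ∫ y, ‖f (z + y) - f y‖ := by
  let F : Lp E 1 (volume : Measure V) := (memLp_one_iff_integrable.2 hf).toLp f
  have : Fact ((1 : ENNReal) ≠ ⊤) := ⟨ENNReal.one_ne_top⟩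
  have hF : Continuous fun z : V ↦ ‖(DomAddAct.mk z +ᵥ F) - F‖ :=
    ((DomAddAct.continuous_mk.vadd continuous_const).sub continuous_const).norm
  refine hF.congr fun z ↦ ?_
  rw [L1.norm_eq_integral_norm]
  refine integral_congr_ae ?_
  have h1 : F =ᵐ[volume] f := MemLp.coeFn_toLp _
  have h2 : (DomAddAct.mk z +ᵥ F : Lp E 1 (volume : Measure V)) =ᵐ[volume] fun y ↦ f (z + y) := by
    rw [DomAddAct.mk_vadd_toLp]
    exact MemLp.coeFn_toLp _
  filter_upwards [Lp.coeFn_sub (DomAddAct.mk z +ᵥ F) F, h1, h2] with y h3 h1 h2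
  rw [h3, Pi.sub_apply, h1, h2]

/-- There are Schwartz functions `k`, `h` with `k ∗ h = k` and `k 0 ≠ 0`. -/
theorem exists_schwartzMap_convolution_eq_self :
    ∃ k h : SchwartzMap V ℂ, (∀ x, ∫ y, h y * k (x - y) = k x) ∧ k 0 ≠ 0 := by
  let b : ContDiffBump (0 : V) := ⟨1, 2, by norm_num, by norm_num⟩
  let c : ContDiffBump (0 : V) := ⟨2, 3, by norm_num, by norm_num⟩
  have toS (b : ContDiffBump (0 : V)) : ∃ B : SchwartzMap V ℂ, ∀ x, B x = (b x : ℂ) :=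
    ⟨(b.hasCompactSupport.comp_left (g := Complex.ofRealCLM) (by simp)).toSchwartzMap
      (Complex.ofRealCLM.contDiff.comp b.contDiff), fun x ↦ by simp⟩
  obtain ⟨B, hB⟩ := toS b
  obtain ⟨C, hC⟩ := toS c
  refine ⟨𝓕⁻ B, 𝓕⁻ C, fun x ↦ ?_, ?_⟩
  · have h1 := SchwartzMap.convolution_apply (ContinuousLinearMap.mul ℂ ℂ) (𝓕⁻ C) (𝓕⁻ B) x
    have h2 : SchwartzMap.convolution (ContinuousLinearMap.mul ℂ ℂ) (𝓕⁻ C) (𝓕⁻ B) = 𝓕⁻ B := by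
      rw [← FourierTransform.fourierInv_fourier_eq (F := SchwartzMap V ℂ)
        (SchwartzMap.convolution (ContinuousLinearMap.mul ℂ ℂ) (𝓕⁻ C) (𝓕⁻ B)),
        SchwartzMap.fourier_convolution]
      congr 1
      ext y
      simp only [FourierTransform.fourier_fourierInv_eq, SchwartzMap.pairing_apply_apply, hB, hC,
        ContinuousLinearMap.mul_apply']
      by_cases hy : y ∈ Metric.ball (0 : V) 2
      · rw [c.one_of_mem_closedBall (Metric.ball_subset_closedBall hy)]; simp
      · rw [b.zero_of_le_dist (by simpa using hy)]; simp
    rw [h2] at h1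
    exact h1.symm
  · rw [SchwartzMap.fourierInv_coe, Real.fourierInv_eq]
    simp only [inner_zero_right, AddChar.map_zero_eq_one, one_smul, hB]
    rw [integral_complex_ofReal]
    exact_mod_cast b.integral_pos.ne'

/-- If `h` changes little in `L¹` under translation by `P`, compared with `|∫ w dP|`, and `φ` is
bounded and annihilated by all translates of `w P`, then `φ` is orthogonal to every `k` with
`h ∗ k = k`. -/
theorem integral_mul_eq_zero_of_integral_translate_lt (P : Measure V) [IsProbabilityMeasure P]
    {φ w k h : V → ℂ} (hφ : Measurable φ) {C : ℝ} (hC : ∀ x, ‖φ x‖ ≤ C)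
    (hw : Measurable w) (hw1 : ∀ x, ‖w x‖ ≤ 1) (hk : Measurable k) (hki : Integrable k)
    (hh : Integrable h) (hkh : ∀ x, ∫ y, h y * k (x - y) = k x)
    (hzero : ∀ θ, ∫ x, φ (x + θ) * w x ∂P = 0)
    (hlt : ∫ z, (∫ y, ‖h (-z + y) - h y‖) ∂P < ‖∫ z, w z ∂P‖) :
    ∫ x, φ x * k x = 0 := by
  set u : V → ℂ := fun θ ↦ ∫ x, φ (x + θ) * k x with hu
  have hum : StronglyMeasurable u := by
    refine StronglyMeasurable.integral_prod_right (f := fun θ x ↦ φ (x + θ) * k x) ?_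
    exact Measurable.stronglyMeasurable (by fun_prop)
  have hub (θ : V) : ‖u θ‖ ≤ C * ∫ x, ‖k x‖ := by
    rw [← integral_const_mul]
    refine norm_integral_le_of_norm_le (hki.norm.const_mul C) (.of_forall fun x ↦ ?_)
    rw [norm_mul]
    exact mul_le_mul_of_nonneg_right (hC _) (norm_nonneg _)
  have hconv (θ : V) : u θ = ∫ y, u (y + θ) * h y := by
    have hint : Integrable (fun p : V × V ↦ φ (p.1 + θ) * (h p.2 * k (p.1 - p.2)))
        (volume.prod volume) := by
      have := hh.convolution_integrand (ContinuousLinearMap.mul ℂ ℂ) hki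
      refine Integrable.bdd_mul (c := C) (by simpa using this)
        (Measurable.aestronglyMeasurable (by fun_prop)) (.of_forall fun x ↦ hC _)
    calc u θ = ∫ x, ∫ y, φ (x + θ) * (h y * k (x - y)) := by
          refine integral_congr_ae (.of_forall fun x ↦ ?_)
          simp only [integral_const_mul, hkh]
      _ = ∫ y, ∫ x, φ (x + θ) * (h y * k (x - y)) := integral_integral_swap hint
      _ = ∫ y, u (y + θ) * h y := by
          refine integral_congr_ae (.of_forall fun y ↦ ?_)
          simp only [hu]
          rw [← integral_mul_const, ← integral_add_right_eq_self _ y]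
          refine integral_congr_ae (.of_forall fun x ↦ ?_)
          simp only [add_sub_cancel_right, add_assoc]
          ring
  have hPzero (θ : V) : ∫ z, u (z + θ) * w z ∂P = 0 := by
    have hint : Integrable (fun p : V × V ↦ φ (p.2 + (p.1 + θ)) * (w p.1 * k p.2))
        (P.prod volume) := by
      refine Integrable.bdd_mul (c := C) (Integrable.mul_prod ?_ hki)
        (Measurable.aestronglyMeasurable (by fun_prop)) (.of_forall fun x ↦ hC _)
      exact Integrable.of_bound hw.aestronglyMeasurable 1 (.of_forall hw1)
    calc ∫ z, u (z + θ) * w z ∂P = ∫ z, (∫ x, φ (x + (z + θ)) * (w z * k x)) ∂P := by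
          refine integral_congr_ae (.of_forall fun z ↦ ?_)
          simp only [hu]
          rw [← integral_mul_const]
          refine integral_congr_ae (.of_forall fun x ↦ ?_)
          ring
      _ = ∫ x, ∫ z, φ (x + (z + θ)) * (w z * k x) ∂P := integral_integral_swap hint
      _ = ∫ x, k x * ∫ z, φ (z + (x + θ)) * w z ∂P := by
          refine integral_congr_ae (.of_forall fun x ↦ ?_)
          simp only
          rw [← integral_const_mul]
          refine integral_congr_ae (.of_forall fun z ↦ ?_)
          simp only [add_left_comm z x θ]
          ring
      _ = 0 := by simp [hzero]
  have huh (θ : V) {μ : Measure V} {f : V → ℂ} (hf : Integrable f μ) :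
      Integrable (fun x ↦ u (x + θ) * f x) μ :=
    hf.bdd_mul (f := fun x ↦ u (x + θ))
      (hum.comp_measurable (measurable_add_const θ)).aestronglyMeasurable
      (.of_forall fun x ↦ hub _)
  have hhz (z : V) : Integrable fun y ↦ h (z + y) := hh.comp_add_left z
  have hdiff (z θ : V) : u (z + θ) - u θ = ∫ y, u (y + θ) * (h (-z + y) - h y) := by
    have h1 : u (z + θ) = ∫ y, u (y + θ) * h (-z + y) := by
      rw [hconv, ← integral_add_left_eq_self (fun y ↦ u (y + θ) * h (-z + y)) z]
      refine integral_congr_ae (.of_forall fun y ↦ ?_)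
      simp only [neg_add_cancel_left, add_left_comm y z θ, add_assoc]
    rw [h1, hconv θ, ← integral_sub (huh _ (hhz _)) (huh _ hh)]
    simp only [mul_sub]
  have hbdd : BddAbove (Set.range fun θ ↦ ‖u θ‖) := ⟨_, by rintro _ ⟨θ, rfl⟩; exact hub θ⟩
  set M := ⨆ θ, ‖u θ‖
  have hle (θ : V) : ‖u θ‖ ≤ M := le_ciSup hbdd θ
  have hNc : Continuous fun z : V ↦ ∫ y, ‖h (-z + y) - h y‖ :=
    (continuous_integral_norm_translate_sub hh).comp continuous_neg
  have hNint : Integrable (fun z : V ↦ ∫ y, ‖h (-z + y) - h y‖) P := by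
    refine Integrable.of_bound hNc.aestronglyMeasurable ((∫ y, ‖h y‖) + ∫ y, ‖h y‖)
      (.of_forall fun z ↦ ?_)
    rw [Real.norm_of_nonneg (by positivity)]
    calc _ ≤ ∫ y, (‖h (-z + y)‖ + ‖h y‖) :=
          integral_mono ((hhz _).sub hh).norm ((hhz _).norm.add hh.norm) fun y ↦ norm_sub_le _ _
      _ = _ := by
          rw [integral_add (hhz _).norm hh.norm, integral_add_left_eq_self (fun y ↦ ‖h y‖)]
  have hdle (z θ : V) : ‖u (z + θ) - u θ‖ ≤ M * ∫ y, ‖h (-z + y) - h y‖ := by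
    rw [hdiff, ← integral_const_mul]
    refine norm_integral_le_of_norm_le (((hhz _).sub hh).norm.const_mul M)
      (.of_forall fun y ↦ ?_)
    rw [norm_mul]
    exact mul_le_mul_of_nonneg_right (hle _) (norm_nonneg _)
  have hwi : Integrable w P := Integrable.of_bound hw.aestronglyMeasurable 1 (.of_forall hw1)
  have hkey (θ : V) : ‖∫ z, w z ∂P‖ * ‖u θ‖ ≤ (∫ z, (∫ y, ‖h (-z + y) - h y‖) ∂P) * M := by
    have : (∫ z, w z ∂P) * u θ = - ∫ z, (u (z + θ) - u θ) * w z ∂P := by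
      simp only [sub_mul]
      rw [integral_sub (huh _ hwi) (hwi.const_mul _), hPzero, integral_const_mul]
      ring
    rw [← norm_mul, this, norm_neg, mul_comm _ M, ← integral_const_mul]
    refine norm_integral_le_of_norm_le (hNint.const_mul M) (.of_forall fun z ↦ ?_)
    rw [norm_mul]
    exact (mul_le_of_le_one_right (norm_nonneg _) (hw1 z)).trans (hdle z θ)
  have hM0 : M ≤ 0 := by
    by_contra! hpos
    have hc : 0 < ‖∫ z, w z ∂P‖ := lt_of_le_of_lt (by positivity) hlt
    have h1 : M ≤ (∫ z, (∫ y, ‖h (-z + y) - h y‖) ∂P) * M / ‖∫ z, w z ∂P‖ :=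
      ciSup_le fun θ ↦ (le_div_iff₀ hc).2 (by rw [mul_comm]; exact hkey θ)
    rw [le_div_iff₀ hc, mul_comm] at h1
    exact absurd (le_of_mul_le_mul_right h1 hpos) (not_le.2 hlt)
  have := norm_le_zero_iff.1 ((hle 0).trans hM0)
  simpa [hu] using this

theorem fourier_mul_comp_smul_eq_zero (P : Measure V) [IsProbabilityMeasure P]
    {φ k h : V → ℂ} (hφ : Measurable φ) {C : ℝ} (hC : ∀ x, ‖φ x‖ ≤ C)
    (hk : Measurable k) (hki : Integrable k)
    (hh : Integrable h) (hkh : ∀ x, ∫ y, h y * k (x - y) = k x)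
    (hzero : ∀ θ, ∫ x, φ (x + θ) ∂P = 0) {δ : ℝ} (hδ : 0 < δ) (s : V)
    (hlt : ∫ z, (∫ y, ‖h (-(δ • z) + y) - h y‖) ∂P < ‖∫ z, (𝐞 (inner ℝ z s) : ℂ) ∂P‖) :
    𝓕 (fun x ↦ φ x * k (δ • x)) s = 0 := by
  have hsm : AEMeasurable (fun z : V ↦ δ • z) P := by fun_prop
  have := Measure.isProbabilityMeasure_map hsm
  have hNm : Continuous fun z : V ↦ ∫ y, ‖h (-z + y) - h y‖ :=
    (continuous_integral_norm_translate_sub hh).comp continuous_neg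
  have key := integral_mul_eq_zero_of_integral_translate_lt (P.map (δ • ·))
    (φ := fun x ↦ φ (δ⁻¹ • x) * (𝐞 (-inner ℝ (δ⁻¹ • x) s) : ℂ))
    (w := fun z ↦ (𝐞 (inner ℝ (δ⁻¹ • z) s) : ℂ)) (k := k) (h := h) (C := C)
    ((hφ.comp (measurable_const_smul _)).mul (Continuous.measurable (by fun_prop)))
    (fun x ↦ by simpa only [norm_mul, Circle.norm_coe, mul_one] using hC _)
    (Continuous.measurable (by fun_prop)) (fun z ↦ (Circle.norm_coe _).le) hk hki hh hkh ?_ ?_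
  · rw [Real.fourier_eq]
    have h1 := Measure.integral_comp_smul (volume : Measure V)
      (fun x ↦ φ (δ⁻¹ • x) * (𝐞 (-inner ℝ (δ⁻¹ • x) s) : ℂ) * k x) δ
    rw [key, smul_zero] at h1
    rw [← h1]
    refine integral_congr_ae (.of_forall fun x ↦ ?_)
    simp only [inv_smul_smul₀ hδ.ne', Circle.smul_def, smul_eq_mul]
    ring
  · intro θ
    rw [integral_map hsm (Measurable.aestronglyMeasurable (by fun_prop))]
    have h2 : ∀ x : V, φ (δ⁻¹ • (δ • x + θ)) * (𝐞 (-inner ℝ (δ⁻¹ • (δ • x + θ)) s) : ℂ) *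
        (𝐞 (inner ℝ (δ⁻¹ • δ • x) s) : ℂ) =
        φ (x + δ⁻¹ • θ) * (𝐞 (-inner ℝ (δ⁻¹ • θ) s) : ℂ) := by
      intro x
      rw [smul_add, inv_smul_smul₀ hδ.ne', mul_assoc, ← Circle.coe_mul, ← AddChar.map_add_eq_mul]
      congr 4
      rw [inner_add_left]; ring
    simp only [h2, integral_mul_const, hzero, zero_mul]
  · rw [integral_map hsm hNm.aestronglyMeasurable,
      integral_map hsm (Continuous.aestronglyMeasurable (by fun_prop))]
    simpa only [inv_smul_smul₀ hδ.ne'] using hlt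

theorem tendsto_integral_integral_norm_translate_smul_sub (P : Measure V) [IsProbabilityMeasure P]
    {h : V → ℂ} (hh : Integrable h) :
    Filter.Tendsto (fun δ : ℝ ↦ ∫ z, (∫ y, ‖h (-(δ • z) + y) - h y‖) ∂P) (𝓝 0) (𝓝 0) := by
  have hNm := continuous_integral_norm_translate_sub hh
  have : Continuous fun δ : ℝ ↦ ∫ z, (∫ y, ‖h (-(δ • z) + y) - h y‖) ∂P := by
    refine continuous_of_dominated (bound := fun _ ↦ (∫ y, ‖h y‖) + ∫ y, ‖h y‖)
      (fun δ ↦ (hNm.comp (by fun_prop : Continuous fun z : V ↦ -(δ • z))).aestronglyMeasurable)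
      (fun δ ↦ .of_forall fun z ↦ ?_) (integrable_const _)
      (.of_forall fun z ↦ hNm.comp (by fun_prop : Continuous fun δ : ℝ ↦ -(δ • z)))
    have hhz : Integrable fun y ↦ h (-(δ • z) + y) := hh.comp_add_left _
    rw [Real.norm_of_nonneg (by positivity)]
    calc _ ≤ ∫ y, (‖h (-(δ • z) + y)‖ + ‖h y‖) :=
          integral_mono (hhz.sub hh).norm (hhz.norm.add hh.norm) fun y ↦ norm_sub_le _ _
      _ = _ := by
          rw [integral_add hhz.norm hh.norm, integral_add_left_eq_self (fun y ↦ ‖h y‖)]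
  simpa using this.tendsto 0

theorem integral_fourier_mul_eq_integral_mul_fourier {f g : V → ℂ} (hf : Integrable f)
    (hg : Integrable g) : ∫ x, 𝓕 f x * g x = ∫ x, f x * 𝓕 g x := by
  simpa using! (VectorFourier.integral_fourierIntegral_smul_eq_flip (L := innerₗ V)
    Real.continuous_fourierChar continuous_inner hf hg)

theorem integral_mul_fourier_eq_zero (P : Measure V) [IsProbabilityMeasure P]
    (hchar : ∀ s : V, ∫ z, (𝐞 (inner ℝ z s) : ℂ) ∂P ≠ 0)
    {φ : V → ℂ} (hφ : Measurable φ) {C : ℝ} (hC : ∀ x, ‖φ x‖ ≤ C)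
    (hzero : ∀ θ, ∫ x, φ (x + θ) ∂P = 0)
    {χ : V → ℂ} (hχ : Integrable χ) (hχc : HasCompactSupport χ) (hχF : Integrable (𝓕 χ)) :
    ∫ x, φ x * 𝓕 χ x = 0 := by
  obtain ⟨k, h, hkh, hk0⟩ := exists_schwartzMap_convolution_eq_self (V := V)
  obtain ⟨ε, hε, hεle⟩ : ∃ ε > 0, ∀ s ∈ tsupport χ, ε ≤ ‖∫ z, (𝐞 (inner ℝ z s) : ℂ) ∂P‖ := by
    have hc : Continuous fun s : V ↦ ‖∫ z, (𝐞 (inner ℝ z s) : ℂ) ∂P‖ := by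
      refine (continuous_of_dominated (bound := fun _ ↦ 1)
        (fun s ↦ Continuous.aestronglyMeasurable (by fun_prop))
        (fun s ↦ .of_forall fun z ↦ (Circle.norm_coe _).le)
        (integrable_const _) (.of_forall fun z ↦ by fun_prop)).norm
    rcases (tsupport χ).eq_empty_or_nonempty with he | hne
    · exact ⟨1, one_pos, by simp [he]⟩
    · obtain ⟨s, -, hs⟩ := IsCompact.exists_isMinOn hχc hne hc.continuousOn
      exact ⟨_, norm_pos_iff.2 (hchar s), hs⟩
  have hev : ∀ᶠ δ : ℝ in 𝓝[>] 0, ∫ x, φ x * k (δ • x) * 𝓕 χ x = 0 := by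
    filter_upwards [self_mem_nhdsWithin, nhdsWithin_le_nhds
      ((tendsto_integral_integral_norm_translate_smul_sub P h.integrable).eventually_lt_const hε)]
      with δ hδ hlt
    have hkδ : Integrable fun x ↦ φ x * k (δ • x) :=
      (k.integrable.comp_smul (ne_of_gt hδ)).bdd_mul hφ.aestronglyMeasurable (.of_forall hC)
    rw [← integral_fourier_mul_eq_integral_mul_fourier hkδ hχ]
    refine integral_eq_zero_of_ae (.of_forall fun s ↦ ?_)
    by_cases hs : s ∈ tsupport χ
    · simp [fourier_mul_comp_smul_eq_zero P hφ hC k.continuous.measurable k.integrable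
        h.integrable hkh hzero hδ s (hlt.trans_le (hεle s hs))]
    · simp [image_eq_zero_of_notMem_tsupport hs]
  obtain ⟨K, hK⟩ : ∃ K, ∀ x, ‖k x‖ ≤ K :=
    ⟨‖k.toBoundedContinuousFunction‖, k.toBoundedContinuousFunction.norm_coe_le_norm⟩
  have hlim : Filter.Tendsto (fun δ : ℝ ↦ ∫ x, φ x * k (δ • x) * 𝓕 χ x) (𝓝[>] 0)
      (𝓝 (∫ x, φ x * k 0 * 𝓕 χ x)) := by
    refine tendsto_integral_filter_of_dominated_convergence (fun x ↦ C * K * ‖𝓕 χ x‖)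
      (.of_forall fun δ ↦ ?_) (.of_forall fun δ ↦ .of_forall fun x ↦ ?_)
      (hχF.norm.const_mul _) (.of_forall fun x ↦ ?_)
    · exact AEStronglyMeasurable.mul
        (hφ.mul (k.continuous.comp (continuous_const_smul δ)).measurable).aestronglyMeasurable
        hχF.aestronglyMeasurable
    · rw [norm_mul, norm_mul]
      have := (norm_nonneg _).trans (hC x)
      gcongr
      exacts [hC x, hK _]
    · have : Continuous fun δ : ℝ ↦ φ x * k (δ • x) * 𝓕 χ x := by
        have := k.continuous
        fun_prop
      simpa using (this.tendsto 0).mono_left nhdsWithin_le_nhds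
  have := tendsto_nhds_unique hlim (tendsto_const_nhds.congr' (hev.mono fun _ h ↦ h.symm))
  have h2 : ∫ x, φ x * k 0 * 𝓕 χ x = (∫ x, φ x * 𝓕 χ x) * k 0 := by
    rw [← integral_mul_const]
    exact integral_congr_ae (.of_forall fun x ↦ by ring)
  rw [h2] at this
  exact (mul_eq_zero.1 this).resolve_right hk0

/-- The Fourier transform is injective on integrable functions. -/
theorem ae_eq_zero_of_fourier_eq_zero {f : V → ℂ} (hf : Integrable f) (h : ∀ s, 𝓕 f s = 0) :
    f =ᵐ[volume] 0 := by
  refine ae_eq_zero_of_integral_contDiff_smul_eq_zero hf.locallyIntegrable fun g hg hgc ↦ ?_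
  let G : SchwartzMap V ℂ := (hgc.comp_left (g := Complex.ofRealCLM) (by simp)).toSchwartzMap
    (Complex.ofRealCLM.contDiff.comp hg)
  have hG (x : V) : 𝓕 (⇑(𝓕⁻ G : SchwartzMap V ℂ)) x = g x := by
    rw [← SchwartzMap.fourier_coe, FourierTransform.fourier_fourierInv_eq]
    simp [G]
  have := integral_fourier_mul_eq_integral_mul_fourier hf (𝓕⁻ G : SchwartzMap V ℂ).integrable
  simp only [h, zero_mul, integral_zero, hG] at this
  rw [this]
  exact integral_congr_ae (.of_forall fun x ↦ by simp [mul_comm])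

theorem fourier_comp_sub_right (f : V → ℂ) (s x : V) :
    𝓕 (fun y ↦ f (y - s)) x = 𝐞 (-inner ℝ s x) * 𝓕 f x := by
  rw [Real.fourier_eq, Real.fourier_eq, ← integral_const_mul, ← integral_add_right_eq_self _ s]
  refine integral_congr_ae (.of_forall fun y ↦ ?_)
  simp only [add_sub_cancel_right, Circle.smul_def, smul_eq_mul, inner_add_left, neg_add,
    AddChar.map_add_eq_mul, Circle.coe_mul]
  ring

/-- Wiener's theorem: translates of a probability measure whose characteristic function has no
zeros separate bounded measurable functions. -/
theorem ae_eq_zero_of_forall_integral_translate_eq_zero (P : Measure V) [IsProbabilityMeasure P]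
    (hchar : ∀ s : V, ∫ z, (𝐞 (inner ℝ z s) : ℂ) ∂P ≠ 0)
    {φ : V → ℂ} (hφ : Measurable φ) {C : ℝ} (hC : ∀ x, ‖φ x‖ ≤ C)
    (hzero : ∀ θ, ∫ x, φ (x + θ) ∂P = 0) : φ =ᵐ[volume] 0 := by
  let b : ContDiffBump (0 : V) := ⟨1, 2, by norm_num, by norm_num⟩
  have hbc : HasCompactSupport (Complex.ofRealCLM ∘ b) :=
    b.hasCompactSupport.comp_left (g := Complex.ofRealCLM) (by simp)
  let B : SchwartzMap V ℂ := hbc.toSchwartzMap (Complex.ofRealCLM.contDiff.comp b.contDiff)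
  have hB0 : 𝓕 (⇑B) 0 ≠ 0 := by
    have : 𝓕 (⇑B) 0 = ((∫ x, b x : ℝ) : ℂ) := by
      rw [Real.fourier_eq, ← integral_complex_ofReal]
      simp [B]
    rw [this]
    exact_mod_cast b.integral_pos.ne'
  have hmul {φ : V → ℂ} (hφ : Measurable φ) (hC : ∀ x, ‖φ x‖ ≤ C)
      (hzero : ∀ θ, ∫ x, φ (x + θ) ∂P = 0) : (fun x ↦ φ x * 𝓕 (⇑B) x) =ᵐ[volume] 0 := by
    have hFB : Integrable (𝓕 (⇑B)) := (𝓕 B).integrable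
    refine ae_eq_zero_of_fourier_eq_zero (hFB.bdd_mul hφ.aestronglyMeasurable (.of_forall hC))
      fun s ↦ ?_
    have hF : 𝓕 (fun y ↦ B (y - s)) = fun x ↦ 𝐞 (-inner ℝ s x) * 𝓕 (⇑B) x :=
      funext (fourier_comp_sub_right B s)
    have := integral_mul_fourier_eq_zero P hchar hφ hC hzero (χ := fun y ↦ B (y - s))
      (B.integrable.comp_sub_right s) (hbc.comp_homeomorph (Homeomorph.subRight s)) (by
        rw [hF]
        exact hFB.bdd_mul (c := 1) (Continuous.aestronglyMeasurable (by fun_prop))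
          (.of_forall fun x ↦ (Circle.norm_coe _).le))
    rw [Real.fourier_eq, ← this, hF]
    refine integral_congr_ae (.of_forall fun x ↦ ?_)
    simp only [Circle.smul_def, smul_eq_mul, real_inner_comm]
    ring
  refine measure_null_of_locally_null _ fun a _ ↦ ?_
  have hcont : Continuous (𝓕 (⇑B)) := (𝓕 B).continuous
  have hnear : ∀ᶠ x in 𝓝 a, 𝓕 (⇑B) (x - a) ≠ 0 := by
    refine ContinuousAt.eventually_ne (by fun_prop) (by simpa using hB0)
  have ha := hmul (hφ.comp (measurable_add_const a)) (fun x ↦ hC _) fun θ ↦ by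
    simpa [add_assoc] using hzero (θ + a)
  have ha' : ∀ᵐ x, φ x * 𝓕 (⇑B) (x - a) = 0 := by
    have := (measurePreserving_sub_right volume a).quasiMeasurePreserving.ae ha
    simpa using this
  refine ⟨_, inter_mem_nhdsWithin _ hnear, measure_mono_null ?_ ha'⟩
  rintro x ⟨hx1, hx2⟩
  exact mul_ne_zero hx1 hx2

/-- The integral of a bounded function against a translate of an absolutely continuous measure
depends continuously on the translation. -/
theorem continuous_integral_translate {P : Measure V} [IsFiniteMeasure P] (hac : P ≪ volume)
    {φ : V → ℂ} (hφ : Measurable φ) {C : ℝ} (hC : ∀ x, ‖φ x‖ ≤ C) :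
    Continuous fun θ ↦ ∫ x, φ (x + θ) ∂P := by
  set f : V → ℝ := fun x ↦ (P.rnDeriv volume x).toReal with hf
  have hfi : Integrable f := Measure.integrable_toReal_rnDeriv
  have hfz (θ : V) : Integrable fun x ↦ f (-θ + x) := hfi.comp_add_left _
  have heq (θ : V) : ∫ x, φ (x + θ) ∂P = ∫ x, f (-θ + x) • φ x := by
    rw [← integral_rnDeriv_smul hac, ← integral_add_left_eq_self (fun x ↦ f (-θ + x) • φ x) θ]
    simp only [neg_add_cancel_left, hf, add_comm _ θ]
  have hint (θ : V) : Integrable fun x ↦ f (-θ + x) • φ x :=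
    (hfz θ).smul_bdd C hφ.aestronglyMeasurable (.of_forall hC)
  have hN := continuous_integral_norm_translate_sub hfi
  rw [continuous_iff_continuousAt]
  intro θ₀
  have h0 : Filter.Tendsto (fun θ ↦ (∫ y, ‖f ((θ₀ - θ) + y) - f y‖) * C) (𝓝 θ₀) (𝓝 0) := by
    have : Continuous fun θ ↦ (∫ y, ‖f ((θ₀ - θ) + y) - f y‖) * C :=
      (hN.comp (continuous_const.sub continuous_id)).mul_const C
    simpa using this.tendsto θ₀
  rw [ContinuousAt, tendsto_iff_norm_sub_tendsto_zero]
  refine squeeze_zero (fun _ ↦ norm_nonneg _) (fun θ ↦ ?_) h0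
  rw [heq, heq, ← integral_sub (hint θ) (hint θ₀), ← integral_mul_const,
    ← integral_add_left_eq_self _ θ₀]
  have hd : Integrable fun y ↦ f ((θ₀ - θ) + y) - f y := (hfi.comp_add_left _).sub hfi
  refine norm_integral_le_of_norm_le (hd.norm.mul_const C) (.of_forall fun y ↦ ?_)
  rw [← sub_smul, norm_smul, neg_add_cancel_left, ← add_assoc, neg_add_eq_sub]
  exact mul_le_mul_of_nonneg_left (hC _) (norm_nonneg _)

end

/-- Bounded completeness of a dense shift family on ℝ^d whose characteristic function has
no zeros (Wiener closure theorem argument, Remark 3.4 (a)). -/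
theorem stmt10 {d : ℕ} (P : Measure (Fin d → ℝ)) [IsProbabilityMeasure P]
    (hac : P ≪ volume)
    (hchar : ∀ t : Fin d → ℝ,
      ∫ x, Complex.exp (Complex.I * ((∑ i, t i * x i : ℝ) : ℂ)) ∂P ≠ 0)
    (Θ : Set (Fin d → ℝ)) (hdense : Dense Θ)
    (φ : (Fin d → ℝ) → ℝ) (hφmeas : Measurable φ) (hφbd : ∃ C, ∀ x, |φ x| ≤ C)
    (hzero : ∀ θ ∈ Θ, ∫ x, φ x ∂(P.map (· + θ)) = 0) :
    ∀ θ : Fin d → ℝ, φ =ᵐ[P.map (· + θ)] 0 := by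
  obtain ⟨C, hC⟩ := hφbd
  have hto : MeasurePreserving (WithLp.toLp 2 : (Fin d → ℝ) → EuclideanSpace ℝ (Fin d)) :=
    PiLp.volume_preserving_toLp (Fin d)
  have hof : Measurable (WithLp.ofLp : EuclideanSpace ℝ (Fin d) → (Fin d → ℝ)) :=
    (PiLp.volume_preserving_ofLp (Fin d)).measurable
  set Q : Measure (EuclideanSpace ℝ (Fin d)) := P.map (WithLp.toLp 2) with hQ
  have : IsProbabilityMeasure Q := Measure.isProbabilityMeasure_map hto.measurable.aemeasurable
  have hQac : Q ≪ volume := hto.map_eq ▸ hac.map hto.measurable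
  have hψ : Measurable fun x : EuclideanSpace ℝ (Fin d) ↦ (φ x.ofLp : ℂ) :=
    Complex.measurable_ofReal.comp (hφmeas.comp hof)
  have hψC (x : EuclideanSpace ℝ (Fin d)) : ‖(φ x.ofLp : ℂ)‖ ≤ C := by simpa using hC _
  have hQΘ : ∀ θ ∈ (WithLp.toLp 2 '' Θ : Set (EuclideanSpace ℝ (Fin d))),
      ∫ x, (φ (x + θ).ofLp : ℂ) ∂Q = 0 := by
    rintro _ ⟨θ, hθ, rfl⟩
    have h1 := hzero θ hθ
    rw [integral_map (by fun_prop) hφmeas.aestronglyMeasurable] at h1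
    rw [hQ, integral_map (f := fun x ↦ (φ (x + WithLp.toLp 2 θ).ofLp : ℂ))
      hto.measurable.aemeasurable
      (hψ.comp (measurable_add_const _)).aestronglyMeasurable]
    simp only [WithLp.ofLp_add]
    rw [integral_complex_ofReal, h1, Complex.ofReal_zero]
  have hΘd : Dense (WithLp.toLp 2 '' Θ : Set (EuclideanSpace ℝ (Fin d))) :=
    (WithLp.toLp_surjective 2).denseRange.dense_image (PiLp.continuous_toLp 2 _) hdense
  have hQzero (θ : EuclideanSpace ℝ (Fin d)) : ∫ x, (φ (x + θ).ofLp : ℂ) ∂Q = 0 :=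
    congrFun ((continuous_integral_translate hQac hψ hψC).ext_on hΘd continuous_const hQΘ) θ
  have hQchar (s : EuclideanSpace ℝ (Fin d)) : ∫ z, (𝐞 (inner ℝ z s) : ℂ) ∂Q ≠ 0 := by
    rw [hQ, integral_map hto.measurable.aemeasurable
      (Continuous.aestronglyMeasurable (by fun_prop))]
    convert hchar (fun i ↦ 2 * Real.pi * s i) using 3 with x
    rw [Real.fourierChar_apply, PiLp.inner_apply, mul_comm Complex.I]
    congr 3
    rw [Finset.mul_sum]
    refine Finset.sum_congr rfl fun i _ ↦ ?_
    simp
    ring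
  have hae := hto.quasiMeasurePreserving.ae
    (ae_eq_zero_of_forall_integral_translate_eq_zero Q hQchar hψ hψC hQzero)
  intro θ
  have hPθ : P.map (· + θ) ≪ volume := by
    simpa [map_add_right_eq_self] using hac.map (measurable_add_const θ)
  filter_upwards [hPθ.ae_le hae] with x hx
  simpa using hx
end
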